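/- arXiv:1810.08286 — 5 statements merged into one kernel-verified Lean document; each statement's English description precedes it below -/
import Mathlib

section
/- Let H be an infinite-dimensional complex Hilbert space and let T be a positive bounded linear operator on H. Then T is absolutely norm attaining if and only if there exists α ≥ 0 such that the essential spectrum of T is exactly the singleton {α} and the set {λ ∈ σ(T) : λ < α} is finite. -/
/-- A bounded operator `T` on a complex inner product space is *absolutely norm attaining*
if for every nonzero closed subspace `M`, some point of the closed unit ball of `M`
attains the supremum of `‖T x‖` over that ball. -/
def IsAbsNormAttaining {H : Type*} [NormedAddCommGroup H] [InnerProductSpace ℂ H]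
    (T : H →L[ℂ] H) : Prop :=
  ∀ M : Submodule ℂ H, IsClosed (M : Set H) → M ≠ ⊥ →
    ∃ x₀ ∈ M, ‖x₀‖ ≤ 1 ∧ ‖T x₀‖ = sSup ((fun x => ‖T x‖) '' {x : H | x ∈ M ∧ ‖x‖ ≤ 1})

/-- The *essential spectrum* of `T`: the spectrum of the image of `T` in the Calkin algebra,
i.e. the set of `λ` such that `T - λ·I` is not invertible modulo the compact operators. -/
def essSpectrum {H : Type*} [NormedAddCommGroup H] [InnerProductSpace ℂ H]
    (T : H →L[ℂ] H) : Set ℂ :=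
  {lam : ℂ | ¬ ∃ S : H →L[ℂ] H,
      IsCompactOperator (S * (T - lam • 1) - 1 : H →L[ℂ] H) ∧
      IsCompactOperator ((T - lam • 1) * S - 1 : H →L[ℂ] H)}


namespace ANProof

variable {H : Type*} [NormedAddCommGroup H] [InnerProductSpace ℂ H]

/-- The real quadratic form of an operator. -/
noncomputable def qf (B : H →L[ℂ] H) (x : H) : ℝ := (inner ℂ (B x) x).re

theorem qf_le (B : H →L[ℂ] H) (x : H) : qf B x ≤ ‖B‖ * ‖x‖ ^ 2 := by
  have h1 : qf B x ≤ ‖inner ℂ (B x) x‖ := Complex.re_le_norm _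
  have h2 := norm_inner_le_norm (𝕜 := ℂ) (B x) x
  have h3 := B.le_opNorm x
  nlinarith [norm_nonneg x]

theorem qf_neg (B : H →L[ℂ] H) (x : H) : qf (-B) x = - qf B x := by
  simp [qf]

theorem qf_sub_smul (B : H →L[ℂ] H) (c : ℝ) (x : H) :
    qf (B - (c : ℂ) • 1) x = qf B x - c * ‖x‖ ^ 2 := by
  simp only [qf, sub_apply, smul_apply,
    one_apply_eq_self, inner_sub_left, inner_smul_left, inner_self_eq_norm_sq_to_K]
  simp [← Complex.ofReal_pow]

theorem qf_smul_sub (B : H →L[ℂ] H) (c : ℝ) (x : H) :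
    qf ((c : ℂ) • 1 - B) x = c * ‖x‖ ^ 2 - qf B x := by
  have := qf_neg (B - (c : ℂ) • 1) x
  rw [neg_sub, qf_sub_smul] at this
  linarith

/-- Vectors of norm one in an infinite-dimensional subspace, orthogonal to a finite-dimensional
subspace. -/
theorem exists_unit (M V : Submodule ℂ H) (hM : ¬ FiniteDimensional ℂ M)
    [FiniteDimensional ℂ V] : ∃ x ∈ M, x ∈ Vᗮ ∧ ‖x‖ = 1 := by
  let f : M →ₗ[ℂ] V := (V.orthogonalProjectionOnto : H →ₗ[ℂ] V).comp M.subtype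
  have hf : ¬ Function.Injective f := fun h => hM (FiniteDimensional.of_injective f h)
  rw [← LinearMap.ker_eq_bot, Submodule.eq_bot_iff] at hf
  push Not at hf
  obtain ⟨x, hx, hx0⟩ := hf
  have hx0' : (x : H) ≠ 0 := by simpa using hx0
  have hxV : (x : H) ∈ Vᗮ := by
    have : V.orthogonalProjectionOnto (x : H) = 0 := hx
    simpa using this
  refine ⟨((‖(x : H)‖⁻¹ : ℝ) : ℂ) • (x : H), M.smul_mem _ x.2, Submodule.smul_mem _ _ hxV, ?_⟩
  rw [norm_smul]
  simp [hx0']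

theorem exists_unit' (h_inf : ¬ FiniteDimensional ℂ H) (V : Submodule ℂ H)
    [FiniteDimensional ℂ V] : ∃ x ∈ Vᗮ, ‖x‖ = 1 := by
  obtain ⟨x, _, h⟩ := exists_unit (⊤ : Submodule ℂ H) V
    (fun h => h_inf (Module.Finite.equiv (Submodule.topEquiv (R := ℂ) (M := H))))
  exact ⟨x, h⟩

theorem compact_small [CompleteSpace H] (K : H →L[ℂ] H) (hK : IsCompactOperator K) (ε : ℝ)
    (hε : 0 < ε) :
    ∃ V : Submodule ℂ H, FiniteDimensional ℂ V ∧ ∀ x ∈ Vᗮ, ‖K x‖ ≤ ε * ‖x‖ := by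
  have hc : IsCompact (closure (K '' Metric.closedBall 0 1)) :=
    IsCompactOperator.isCompact_closure_image_closedBall (f := (K : H →ₗ[ℂ] H)) hK 1
  have htb := hc.totallyBounded
  rw [Metric.totallyBounded_iff] at htb
  obtain ⟨t, htf, ht⟩ := htb ε hε
  let W := Submodule.span ℂ t
  have : FiniteDimensional ℂ W := FiniteDimensional.span_of_finite ℂ htf
  refine ⟨W.map (ContinuousLinearMap.adjoint K : H →ₗ[ℂ] H), inferInstance, ?_⟩
  intro x hx
  have hKx : ∀ w ∈ W, inner ℂ w (K x) = 0 := by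
    intro w hw
    rw [← ContinuousLinearMap.adjoint_inner_left]
    exact hx _ (Submodule.mem_map_of_mem hw)
  by_cases hx0 : x = 0
  · simp [hx0]
  have hxn : 0 < ‖x‖ := norm_pos_iff.2 hx0
  have hmem : K (((‖x‖⁻¹ : ℝ) : ℂ) • x) ∈ closure (K '' Metric.closedBall 0 1) := by
    apply subset_closure
    refine ⟨_, ?_, rfl⟩
    rw [mem_closedBall_zero_iff, norm_smul]
    simp [hx0]
  obtain ⟨y, hy, hd⟩ := Set.mem_iUnion₂.1 (ht hmem)
  rw [Metric.mem_ball, dist_eq_norm, map_smul] at hd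
  set z := ((‖x‖⁻¹ : ℝ) : ℂ) • K x with hz
  have horth : inner ℂ y z = 0 := by
    rw [hz, inner_smul_right, hKx y (Submodule.subset_span hy), mul_zero]
  have h1 : ‖z‖ ^ 2 ≤ ‖z - y‖ ^ 2 := by
    have h := @norm_sub_sq ℂ _ _ _ _ z y
    rw [inner_eq_zero_symm.1 horth] at h
    simp at h
    nlinarith [norm_nonneg y]
  have h2 : ‖z‖ ≤ ‖z - y‖ := by
    exact (sq_le_sq₀ (norm_nonneg _) (norm_nonneg _)).1 h1
  have h3 : ‖z‖ = ‖x‖⁻¹ * ‖K x‖ := by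
    rw [hz, norm_smul]; simp
  have h4 : ‖x‖⁻¹ * ‖K x‖ ≤ ε := by rw [← h3]; linarith
  calc ‖K x‖ = ‖x‖ * (‖x‖⁻¹ * ‖K x‖) := by field_simp
    _ ≤ ‖x‖ * ε := by gcongr
    _ = _ := mul_comm _ _

theorem cs_form (B : H →L[ℂ] H) (hB : (B : H →ₗ[ℂ] H).IsSymmetric) (M : Submodule ℂ H)
    (hpos : ∀ x ∈ M, 0 ≤ qf B x) (x y : H) (hx : x ∈ M) (hy : y ∈ M) :
    (inner ℂ (B x) y).re ^ 2 ≤ qf B x * qf B y := by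
  have key : ∀ t : ℝ, 0 ≤ qf B y * (t * t) + 2 * (inner ℂ (B x) y).re * t + qf B x := by
    intro t
    have h := hpos (x + (t : ℂ) • y) (M.add_mem hx (M.smul_mem _ hy))
    have e : (inner ℂ (B y) x).re = (inner ℂ (B x) y).re := by
      have : inner ℂ (B y) x = inner ℂ y (B x) := hB y x
      rw [this, ← inner_conj_symm, Complex.conj_re]
    simp only [qf, map_add, map_smul, inner_add_left, inner_add_right, inner_smul_left,
      inner_smul_right, Complex.add_re, Complex.conj_ofReal, Complex.re_ofReal_mul, e] at h ⊢
    linarith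
  have := discrim_le_zero key
  rw [discrim] at this
  nlinarith

/-- `c` is an essential upper bound of the quadratic form of `B`. -/
def EB (B : H →L[ℂ] H) (c : ℝ) : Prop :=
  ∃ V : Submodule ℂ H, FiniteDimensional ℂ V ∧ ∀ x ∈ Vᗮ, qf B x ≤ c * ‖x‖ ^ 2

/-- The essential upper bound of the numerical range. -/
noncomputable def eu (B : H →L[ℂ] H) : ℝ := sInf {c | EB B c}

theorem EB_norm (B : H →L[ℂ] H) : EB B ‖B‖ :=
  ⟨⊥, inferInstance, fun x _ => qf_le B x⟩

theorem EB_bdd (h_inf : ¬ FiniteDimensional ℂ H) (B : H →L[ℂ] H) :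
    BddBelow {c | EB B c} := by
  refine ⟨-‖B‖, ?_⟩
  rintro c ⟨V, hV, h⟩
  obtain ⟨x, hx, hx1⟩ := exists_unit' h_inf V
  have h1 := h x hx
  have h2 := qf_le (-B) x
  rw [qf_neg, norm_neg] at h2
  rw [hx1] at h1 h2
  linarith

theorem EB_of_gt (B : H →L[ℂ] H) {c : ℝ} (hc : eu B < c) : EB B c := by
  obtain ⟨d, ⟨V, hV, h⟩, hd⟩ := exists_lt_of_csInf_lt (s := {c | EB B c}) ⟨_, EB_norm B⟩ hc
  refine ⟨V, hV, fun x hx => (h x hx).trans ?_⟩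
  gcongr

theorem exists_of_lt (h_inf : ¬ FiniteDimensional ℂ H) (B : H →L[ℂ] H) {c : ℝ} (hc : c < eu B)
    (V : Submodule ℂ H) [FiniteDimensional ℂ V] : ∃ x ∈ Vᗮ, ‖x‖ = 1 ∧ c < qf B x := by
  have h : ¬ EB B c := fun h => not_lt.2 (csInf_le (EB_bdd h_inf B) h) hc
  unfold EB at h
  push Not at h
  obtain ⟨x, hx, hlt⟩ := h V inferInstance
  have hx0 : x ≠ 0 := by
    rintro rfl
    simp [qf] at hlt
  have hxn : 0 < ‖x‖ := norm_pos_iff.2 hx0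
  refine ⟨((‖x‖⁻¹ : ℝ) : ℂ) • x, Submodule.smul_mem _ _ hx, ?_, ?_⟩
  · rw [norm_smul]; simp [hx0]
  · have : qf B (((‖x‖⁻¹ : ℝ) : ℂ) • x) = ‖x‖⁻¹ * (‖x‖⁻¹ * qf B x) := by
      simp only [qf, map_smul, inner_smul_left, inner_smul_right, Complex.conj_ofReal,
        Complex.re_ofReal_mul]
    rw [this]
    have h2 : c = ‖x‖⁻¹ * (‖x‖⁻¹ * (c * ‖x‖ ^ 2)) := by field_simp
    rw [h2]
    gcongr

theorem eu_add_nonneg (h_inf : ¬ FiniteDimensional ℂ H) (B : H →L[ℂ] H) :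
    0 ≤ eu B + eu (-B) := by
  by_contra! hlt
  set δ := -(eu B + eu (-B)) with hδ
  obtain ⟨V, hV, h1⟩ := EB_of_gt B (c := eu B + δ / 3) (by linarith)
  obtain ⟨W, hW, h2⟩ := EB_of_gt (-B) (c := eu (-B) + δ / 3) (by linarith)
  obtain ⟨x, hx, hx1⟩ := exists_unit' h_inf (V ⊔ W)
  have h1 := h1 x (Submodule.orthogonal_le le_sup_left hx)
  have h2 := h2 x (Submodule.orthogonal_le le_sup_right hx)
  rw [qf_neg] at h2
  rw [hx1] at h1 h2
  linarith

theorem weyl (h_inf : ¬ FiniteDimensional ℂ H) (B : H →L[ℂ] H)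
    (hB : (B : H →ₗ[ℂ] H).IsSymmetric) (W : Submodule ℂ H) [FiniteDimensional ℂ W]
    (δ : ℝ) (hδ : 0 < δ) : ∃ x ∈ Wᗮ, ‖x‖ = 1 ∧ ‖(B - (eu B : ℂ) • 1) x‖ ≤ δ := by
  set u := eu B with hu
  set R := ‖B‖ + |u| + 1 with hR
  have hRpos : 0 < R := by positivity
  obtain ⟨ε, hε0, hε1, hε2, hε3⟩ : ∃ ε : ℝ, 0 < ε ∧ ε ≤ 1 ∧ ε ≤ δ / 2 ∧ ε ≤ δ ^ 2 / (8 * R) :=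
    ⟨min 1 (min (δ / 2) (δ ^ 2 / (8 * R))), by positivity, min_le_left _ _,
      (min_le_right _ _).trans (min_le_left _ _), (min_le_right _ _).trans (min_le_right _ _)⟩
  obtain ⟨V, hV, hVu⟩ := EB_of_gt B (c := u + ε) (by linarith)
  obtain ⟨x, hx, hx1, hxq⟩ := exists_of_lt h_inf B (c := u - ε) (by linarith)
    (W ⊔ (V ⊔ V.map (B : H →ₗ[ℂ] H)))
  have hxW : x ∈ Wᗮ := Submodule.orthogonal_le le_sup_left hx
  have hxV : x ∈ Vᗮ := Submodule.orthogonal_le (le_sup_left.trans le_sup_right) hx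
  have hxBV : x ∈ (V.map (B : H →ₗ[ℂ] H))ᗮ :=
    Submodule.orthogonal_le (le_sup_right.trans le_sup_right) hx
  refine ⟨x, hxW, hx1, ?_⟩
  set D : H →L[ℂ] H := ((u + ε : ℝ) : ℂ) • 1 - B with hD
  have hDsymm : (D : H →ₗ[ℂ] H).IsSymmetric := by
    intro a b
    have := hB a b
    simp only [ContinuousLinearMap.coe_coe] at this
    simp [hD, inner_sub_left, inner_sub_right, inner_smul_left, inner_smul_right, this]
  have hDpos : ∀ y ∈ Vᗮ, 0 ≤ qf D y := by
    intro y hy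
    rw [hD, qf_smul_sub]
    linarith [hVu y hy]
  have hBx : B x ∈ Vᗮ := by
    intro v hv
    have : inner ℂ (B v) x = inner ℂ v (B x) := hB v x
    rw [← this]
    exact hxBV _ (Submodule.mem_map_of_mem hv)
  have hDx : D x ∈ Vᗮ := by
    simp only [hD, sub_apply, smul_apply,
      one_apply_eq_self]
    exact Submodule.sub_mem _ (Submodule.smul_mem _ _ hxV) hBx
  have hcs := cs_form D hDsymm Vᗮ hDpos x (D x) hxV hDx
  have hDq : qf D x ≤ 2 * ε := by
    rw [hD, qf_smul_sub, hx1]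
    linarith
  have hDn : ‖D‖ ≤ R := by
    calc ‖D‖ ≤ ‖((u + ε : ℝ) : ℂ) • (1 : H →L[ℂ] H)‖ + ‖B‖ := norm_sub_le _ _
      _ ≤ |u + ε| * 1 + ‖B‖ := by
        gcongr
        rw [norm_smul, Complex.norm_real, Real.norm_eq_abs]
        gcongr
        exact ContinuousLinearMap.norm_id_le
      _ ≤ R := by
        have := abs_add_le u ε
        rw [abs_of_pos hε0] at this
        rw [hR]; linarith
  have hre : (inner ℂ (D x) (D x)).re = ‖D x‖ ^ 2 := by
    rw [inner_self_eq_norm_sq_to_K]; simp [← Complex.ofReal_pow]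
  rw [hre] at hcs
  have hDx2 : ‖D x‖ ^ 2 ≤ R * (2 * ε) := by
    have h1 := qf_le D (D x)
    have h0 := hDpos x hxV
    by_cases hz : ‖D x‖ = 0
    · rw [hz, zero_pow two_ne_zero]; positivity
    have hp : 0 < ‖D x‖ ^ 2 := by positivity
    have h2 : (‖D x‖ ^ 2) ^ 2 ≤ (2 * ε) * (R * ‖D x‖ ^ 2) := by
      refine hcs.trans (mul_le_mul hDq (h1.trans ?_) (hDpos _ hDx) (by positivity))
      gcongr
    nlinarith
  have hDx3 : ‖D x‖ ≤ δ / 2 := by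
    have : R * (2 * ε) ≤ (δ / 2) ^ 2 := by
      calc R * (2 * ε) ≤ R * (2 * (δ ^ 2 / (8 * R))) := by gcongr
        _ = (δ / 2) ^ 2 := by field_simp; norm_num
    exact (sq_le_sq₀ (norm_nonneg _) (by positivity)).1 (hDx2.trans this)
  have : (B - (u : ℂ) • 1) x = (ε : ℂ) • x - D x := by
    simp [hD, add_smul]
    abel
  rw [this]
  calc ‖(ε : ℂ) • x - D x‖ ≤ ‖(ε : ℂ) • x‖ + ‖D x‖ := norm_sub_le _ _
    _ ≤ δ / 2 + δ / 2 := by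
      gcongr
      rw [norm_smul, hx1]
      simpa [abs_of_pos hε0] using hε2
    _ = δ := by ring

theorem not_left_inv [CompleteSpace H] (h_inf : ¬ FiniteDimensional ℂ H) (B : H →L[ℂ] H)
    (hB : (B : H →ₗ[ℂ] H).IsSymmetric) (S : H →L[ℂ] H) :
    ¬ IsCompactOperator (S * (B - (eu B : ℂ) • 1) - 1 : H →L[ℂ] H) := by
  intro hK
  obtain ⟨V, hV, h⟩ := compact_small _ hK (1 / 3) (by norm_num)
  obtain ⟨x, hx, hx1, hxd⟩ := weyl h_inf B hB V (1 / (3 * (‖S‖ + 1))) (by positivity)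
  have h1 := h x hx
  rw [hx1] at h1
  have h2 : x = S ((B - (eu B : ℂ) • 1) x) - (S * (B - (eu B : ℂ) • 1) - 1) x := by
    simp
  have h3 : ‖S ((B - (eu B : ℂ) • 1) x)‖ ≤ 1 / 3 := by
    calc _ ≤ ‖S‖ * ‖(B - (eu B : ℂ) • 1) x‖ := S.le_opNorm _
      _ ≤ (‖S‖ + 1) * (1 / (3 * (‖S‖ + 1))) := by gcongr; linarith
      _ = 1 / 3 := by field_simp
  have h4 := norm_sub_le (S ((B - (eu B : ℂ) • 1) x)) ((S * (B - (eu B : ℂ) • 1) - 1) x)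
  rw [← h2, hx1] at h4
  linarith

theorem compact_of_collapse [CompleteSpace H] (B : H →L[ℂ] H)
    (hB : (B : H →ₗ[ℂ] H).IsSymmetric) (β : ℝ) (h1 : eu B = β) (h2 : eu (-B) = -β) :
    IsCompactOperator (B - (β : ℂ) • 1 : H →L[ℂ] H) := by
  set C : H →L[ℂ] H := B - (β : ℂ) • 1 with hC
  have hCs : (C : H →ₗ[ℂ] H).IsSymmetric := by
    intro a b
    have := hB a b
    simp only [ContinuousLinearMap.coe_coe] at this
    simp only [hC, ContinuousLinearMap.coe_coe, sub_apply, smul_apply, one_apply_eq_self,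
      inner_sub_left, inner_sub_right, inner_smul_left, inner_smul_right, this,
      Complex.conj_ofReal]
  have hmem : C ∈ closure {f : H →L[ℂ] H | IsCompactOperator f} := by
    rw [Metric.mem_closure_iff]
    intro ε hε
    obtain ⟨V, hV, hV1⟩ := EB_of_gt B (c := β + ε / 2) (by linarith)
    obtain ⟨W, hW, hW1⟩ := EB_of_gt (-B) (c := -β + ε / 2) (by linarith)
    set U := V ⊔ W with hU
    set P := U.starProjection with hP
    set Q : H →L[ℂ] H := 1 - P with hQ
    have hPc : IsCompactOperator P := by
      have : IsCompactOperator (U.orthogonalProjectionOnto) :=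
        have : ProperSpace U := FiniteDimensional.proper ℂ U
        isCompactOperator_of_locallyCompactSpace_dom (U.orthogonalProjectionOnto)
      exact this.clm_comp U.subtypeL
    have hQs : ∀ a b, inner ℂ (Q a) b = inner ℂ a (Q b) := by
      intro a b
      simp only [hQ, hP, sub_apply, one_apply_eq_self,
        inner_sub_left, inner_sub_right, Submodule.inner_starProjection_left_eq_right]
    have hQmem : ∀ x, Q x ∈ Uᗮ := by
      intro x
      exact U.sub_starProjection_mem_orthogonal x
    have hQn : ∀ x, ‖Q x‖ ≤ ‖x‖ := by
      intro x
      have : Q x = Uᗮ.starProjection x := by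
        rw [Submodule.starProjection_orthogonal']
      rw [this]
      exact Uᗮ.norm_starProjection_apply_le x
    have hbound : ∀ x ∈ Uᗮ, |qf C x| ≤ ε / 2 * ‖x‖ ^ 2 := by
      intro x hx
      have a1 := hV1 x (Submodule.orthogonal_le le_sup_left hx)
      have a2 := hW1 x (Submodule.orthogonal_le le_sup_right hx)
      rw [qf_neg] at a2
      rw [hC, qf_sub_smul, abs_le]
      constructor <;> linarith
    refine ⟨C - Q * C * Q, ?_, ?_⟩
    · have : C - Q * C * Q = P * C + Q * (C * P) := by
        rw [hQ]; noncomm_ring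
      rw [this]
      have c1 : IsCompactOperator (P * C : H →L[ℂ] H) := hPc.comp_clm C
      have c2 : IsCompactOperator (Q * (C * P) : H →L[ℂ] H) := hPc.clm_comp (Q * C)
      exact c1.add c2
    · rw [dist_eq_norm, sub_sub_cancel]
      have hs : ((Q * C * Q : H →L[ℂ] H) : H →ₗ[ℂ] H).IsSymmetric := by
        intro a b
        have := hCs (Q a) (Q b)
        simp only [ContinuousLinearMap.coe_coe] at this
        simp [hQs, this]
      rw [ContinuousLinearMap.norm_eq_iSup_rayleighQuotient _ hs]
      refine lt_of_le_of_lt (ciSup_le (c := ε / 2) ?_) (by linarith)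
      intro x
      have e1 : (Q * C * Q).reApplyInnerSelf x = qf C (Q x) := by
        simp [ContinuousLinearMap.reApplyInnerSelf, qf, hQs]
      rw [ContinuousLinearMap.rayleighQuotient, e1, abs_div, abs_of_nonneg (sq_nonneg ‖x‖)]
      apply div_le_of_le_mul₀ (by positivity) (by positivity)
      refine (hbound _ (hQmem x)).trans ?_
      have := hQn x
      gcongr
  have hcl : IsClosed {f : H →L[ℂ] H | IsCompactOperator f} :=
    isClosed_setOfPred_isCompactOperator
  rwa [hcl.closure_eq] at hmem

theorem an_max {T : H →L[ℂ] H} (hAN : IsAbsNormAttaining T) (M : Submodule ℂ H)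
    (hM : IsClosed (M : Set H)) (hM0 : M ≠ ⊥) :
    ∃ x₀ ∈ M, ‖x₀‖ ≤ 1 ∧ ∀ x ∈ M, ‖x‖ ≤ 1 → ‖T x‖ ≤ ‖T x₀‖ := by
  obtain ⟨x₀, h1, h2, h3⟩ := hAN M hM hM0
  refine ⟨x₀, h1, h2, fun x hx hx1 => ?_⟩
  rw [h3]
  apply le_csSup
  · refine ⟨‖T‖, ?_⟩
    rintro _ ⟨y, ⟨_, hy⟩, rfl⟩
    calc ‖T y‖ ≤ ‖T‖ * ‖y‖ := T.le_opNorm y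
      _ ≤ ‖T‖ * 1 := by gcongr
      _ = ‖T‖ := mul_one _
  · exact ⟨x, ⟨hx, hx1⟩, rfl⟩

theorem an_of_max {T : H →L[ℂ] H}
    (h : ∀ M : Submodule ℂ H, IsClosed (M : Set H) → M ≠ ⊥ →
      ∃ x₀ ∈ M, ‖x₀‖ ≤ 1 ∧ ∀ x ∈ M, ‖x‖ ≤ 1 → ‖T x‖ ≤ ‖T x₀‖) : IsAbsNormAttaining T := by
  intro M hM hM0
  obtain ⟨x₀, h1, h2, h3⟩ := h M hM hM0
  refine ⟨x₀, h1, h2, ?_⟩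
  symm
  apply IsGreatest.csSup_eq
  refine ⟨⟨x₀, ⟨h1, h2⟩, rfl⟩, ?_⟩
  rintro _ ⟨y, ⟨hy, hy1⟩, rfl⟩
  exact h3 y hy hy1

theorem qf_sq {T : H →L[ℂ] H} (hT : (T : H →ₗ[ℂ] H).IsSymmetric) (x : H) :
    qf (T * T) x = ‖T x‖ ^ 2 := by
  have : inner ℂ (T (T x)) x = inner ℂ (T x) (T x) := hT (T x) x
  simp only [qf, mul_apply_eq_comp, this]
  rw [inner_self_eq_norm_sq_to_K]; simp [← Complex.ofReal_pow]

theorem sq_symm {T : H →L[ℂ] H} (hT : (T : H →ₗ[ℂ] H).IsSymmetric) :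
    ((T * T : H →L[ℂ] H) : H →ₗ[ℂ] H).IsSymmetric := by
  intro a b
  have h1 : inner ℂ (T (T a)) b = inner ℂ (T a) (T b) := hT _ _
  have h2 : inner ℂ (T a) (T b) = inner ℂ a (T (T b)) := hT _ _
  exact h1.trans h2

theorem symm_smul_sub {B : H →L[ℂ] H} (hB : (B : H →ₗ[ℂ] H).IsSymmetric) (c : ℝ) :
    (((c : ℂ) • 1 - B : H →L[ℂ] H) : H →ₗ[ℂ] H).IsSymmetric := by
  intro a b
  have := hB a b
  simp only [ContinuousLinearMap.coe_coe] at this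
  simp only [ContinuousLinearMap.coe_coe, sub_apply, smul_apply, one_apply_eq_self,
      inner_sub_left, inner_sub_right, inner_smul_left, inner_smul_right, this,
      Complex.conj_ofReal]

theorem no_seq {T : H →L[ℂ] H} (hT : (T : H →ₗ[ℂ] H).IsSymmetric)
    (hAN : IsAbsNormAttaining T) (f : ℕ → H) (hf1 : ∀ n, ‖f n‖ = 1)
    (hf2 : ∀ m n, m < n → inner ℂ (f m) (f n) = 0)
    (hf3 : ∀ m n, m < n → inner ℂ ((T * T) (f m)) (f n) = 0)
    (hf4 : ∀ m n, m < n → qf (T * T) (f m) < qf (T * T) (f n)) : False := by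
  set A := T * T with hA
  have hAs : (A : H →ₗ[ℂ] H).IsSymmetric := sq_symm hT
  set γ : ℕ → ℝ := fun n => qf A (f n) with hγ
  have hbdd : BddAbove (Set.range γ) := by
    refine ⟨‖A‖, ?_⟩
    rintro _ ⟨n, rfl⟩
    simpa [hf1 n] using qf_le A (f n)
  set u := ⨆ n, γ n with hu
  have hγu : ∀ n, γ n < u := fun n =>
    lt_of_lt_of_le (hf4 n (n + 1) n.lt_succ_self) (le_ciSup hbdd (n + 1))
  set B : H →L[ℂ] H := (u : ℂ) • 1 - A with hB
  have hBs : (B : H →ₗ[ℂ] H).IsSymmetric := symm_smul_sub hAs u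
  have horth : ∀ m n, m ≠ n → inner ℂ (f m) (f n) = 0 := by
    intro m n hmn
    rcases lt_or_gt_of_ne hmn with h | h
    · exact hf2 m n h
    · exact inner_eq_zero_symm.1 (hf2 n m h)
  have horthA : ∀ m n, m ≠ n → inner ℂ (A (f m)) (f n) = 0 := by
    intro m n hmn
    rcases lt_or_gt_of_ne hmn with h | h
    · exact hf3 m n h
    · have : inner ℂ (A (f m)) (f n) = inner ℂ (f m) (A (f n)) := hAs _ _
      rw [this]
      exact inner_eq_zero_symm.1 (hf3 n m h)
  have hself : ∀ n, inner ℂ (f n) (f n) = 1 := by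
    intro n
    rw [inner_self_eq_norm_sq_to_K, hf1]; simp
  have hAself : ∀ n, inner ℂ (A (f n)) (f n) = (γ n : ℂ) := by
    intro n
    have h1 : (inner ℂ (A (f n)) (f n)).im = 0 := hAs.im_inner_apply_self (f n)
    apply Complex.ext
    · simp [hγ, qf]
    · simpa using h1
  set S := Submodule.span ℂ (Set.range f) with hS
  set M := S.topologicalClosure with hMdef
  have hMle : ∀ φ : H →L[ℂ] ℂ, (∀ n, φ (f n) = 0) → ∀ x ∈ M, φ x = 0 := by
    intro φ hφ x hx
    have h1 : S ≤ LinearMap.ker (φ : H →ₗ[ℂ] ℂ) := by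
      rw [hS, Submodule.span_le]
      rintro _ ⟨n, rfl⟩
      exact hφ n
    exact Submodule.topologicalClosure_minimal _ h1 φ.isClosed_ker hx
  have hBf : ∀ n, ∀ x ∈ M, inner ℂ (B (f n)) x = ((u - γ n : ℝ) : ℂ) * inner ℂ (f n) x := by
    intro n x hx
    have := hMle (innerSL ℂ (B (f n)) - ((u - γ n : ℝ) : ℂ) • innerSL ℂ (f n)) (by
      intro m
      simp only [sub_apply, smul_apply, innerSL_apply_apply, hB, one_apply_eq_self,
        inner_sub_left, inner_smul_left, Complex.conj_ofReal]
      by_cases hnm : n = m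
      · subst hnm
        rw [hself, hAself]; simp
      · rw [horth n m hnm, horthA n m hnm]; simp) x hx
    simpa [sub_eq_zero] using this
  have hSM : S ≤ M := S.le_topologicalClosure
  have hposS : ∀ x ∈ S, 0 ≤ qf B x := by
    intro x hx
    have hxM := hSM hx
    obtain ⟨c, hc⟩ := (Finsupp.mem_span_range_iff_exists_finsupp).1 hx
    have hcx : ∀ n ∈ c.support, inner ℂ (f n) x = c n := by
      intro n hn
      rw [← hc, Finsupp.sum, inner_sum, Finset.sum_eq_single n]
      · rw [inner_smul_right, hself, mul_one]
      · intro b _ hb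
        rw [inner_smul_right, horth n b (Ne.symm hb), mul_zero]
      · intro h; exact absurd hn h
    have : qf B x = ∑ n ∈ c.support, (u - γ n) * ‖c n‖ ^ 2 := by
      have e : inner ℂ (B x) x = ∑ n ∈ c.support, (((u - γ n) * ‖c n‖ ^ 2 : ℝ) : ℂ) := by
        have hBx : B x = ∑ n ∈ c.support, c n • B (f n) := by
          conv_lhs => rw [← hc, Finsupp.sum, map_sum]
          simp only [map_smul]
        rw [hBx, sum_inner]
        apply Finset.sum_congr rfl
        intro n hn
        rw [inner_smul_left, hBf n x hxM, hcx n hn, mul_left_comm, Complex.conj_mul']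
        push_cast
        ring
      rw [qf, e, Complex.re_sum]
      simp only [Complex.ofReal_re]
    rw [this]
    exact Finset.sum_nonneg fun n _ => mul_nonneg (by linarith [hγu n]) (sq_nonneg _)
  have hposM : ∀ x ∈ M, 0 ≤ qf B x := by
    intro x hx
    have hcl : IsClosed {x | 0 ≤ qf B x} := by
      apply isClosed_le continuous_const
      unfold qf
      fun_prop
    have hx' : x ∈ closure (S : Set H) := by
      rwa [← Submodule.topologicalClosure_coe]
    exact closure_minimal hposS hcl hx'
  have hfM : ∀ n, f n ∈ M := fun n => hSM (Submodule.subset_span ⟨n, rfl⟩)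
  have hM0 : M ≠ ⊥ := by
    intro h
    have := hfM 0
    rw [h, Submodule.mem_bot] at this
    have h1 := hf1 0
    rw [this] at h1
    simp at h1
  obtain ⟨x₀, hx₀, hx₀1, hmax⟩ := an_max hAN M S.isClosed_topologicalClosure hM0
  have hux : u ≤ ‖T x₀‖ ^ 2 := by
    apply ciSup_le
    intro n
    have h1 := hmax (f n) (hfM n) (hf1 n).le
    simp only [hγ, hA]
    rw [qf_sq hT]
    gcongr
  have hu0 : 0 < u := by
    refine lt_of_le_of_lt ?_ (hγu 0)
    simp only [hγ, hA]
    rw [qf_sq hT]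
    positivity
  have hB0 : qf B x₀ = 0 := by
    apply le_antisymm _ (hposM x₀ hx₀)
    rw [hB, qf_smul_sub, hA, qf_sq hT]
    have : ‖x₀‖ ^ 2 ≤ 1 := by nlinarith [norm_nonneg x₀]
    nlinarith
  have hin : ∀ n, inner ℂ (f n) x₀ = 0 := by
    intro n
    have hcs := cs_form B hBs M hposM x₀ ((inner ℂ (f n) x₀) • f n) hx₀ (M.smul_mem _ (hfM n))
    rw [hB0, zero_mul] at hcs
    have e : inner ℂ (B x₀) ((inner ℂ (f n) x₀) • f n)
        = (((u - γ n) * ‖inner ℂ (f n) x₀‖ ^ 2 : ℝ) : ℂ) := by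
      have h1 : inner ℂ (B x₀) (f n) = inner ℂ x₀ (B (f n)) := hBs _ _
      rw [inner_smul_right, h1, ← inner_conj_symm x₀ (B (f n)), hBf n x₀ hx₀, map_mul, Complex.conj_ofReal,
        mul_left_comm, Complex.mul_conj']
      push_cast
      ring
    rw [e, Complex.ofReal_re] at hcs
    have h2 : (u - γ n) * ‖inner ℂ (f n) x₀‖ ^ 2 = 0 := by
      have := le_antisymm hcs (sq_nonneg _)
      simpa using this
    have h3 : u - γ n ≠ 0 := by linarith [hγu n]
    simpa [h3] using h2
  have hx00 : inner ℂ x₀ x₀ = 0 := by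
    have := hMle (innerSL ℂ x₀) (fun n => by
      rw [innerSL_apply_apply]; exact inner_eq_zero_symm.1 (hin n)) x₀ hx₀
    simpa using this
  rw [inner_self_eq_zero] at hx00
  rw [hx00] at hux
  simp at hux
  linarith

theorem an_collapse (h_inf : ¬ FiniteDimensional ℂ H) {T : H →L[ℂ] H}
    (hT : (T : H →ₗ[ℂ] H).IsSymmetric)
    (hAN : IsAbsNormAttaining T) : eu (-(T * T)) = - eu (T * T) := by
  set A := T * T with hA
  have hAs : (A : H →ₗ[ℂ] H).IsSymmetric := sq_symm hT
  by_contra hne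
  have hlt : - eu (-A) < eu A := by
    have := eu_add_nonneg h_inf A
    rcases lt_or_eq_of_le this with h | h
    · linarith
    · exact absurd (by linarith) hne
  set P : H → Prop := fun x => ‖x‖ = 1 ∧ qf A x < eu A with hP
  set r : H → H → Prop := fun x y => inner ℂ x y = 0 ∧ inner ℂ (A x) y = 0 ∧ qf A x < qf A y
    with hr
  obtain ⟨f, hf1, hf2⟩ := exists_seq_of_forall_finset_exists P r (by
    intro s hs
    classical
    obtain ⟨c, hc1, hc2, hc3⟩ : ∃ c, -eu (-A) < c ∧ c < eu A ∧ ∀ x ∈ s, qf A x < c := by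
      set t := insert (-eu (-A)) (s.image (qf A)) with ht
      have htn : t.Nonempty := Finset.insert_nonempty _ _
      have hm : t.max' htn < eu A := by
        rw [Finset.max'_lt_iff]
        intro y hy
        rw [ht, Finset.mem_insert, Finset.mem_image] at hy
        rcases hy with rfl | ⟨x, hx, rfl⟩
        · exact hlt
        · exact (hs x hx).2
      obtain ⟨c, hc1, hc2⟩ := exists_between hm
      refine ⟨c, ?_, hc2, ?_⟩
      · exact lt_of_le_of_lt (t.le_max' _ (Finset.mem_insert_self _ _)) hc1
      · intro x hx
        exact lt_of_le_of_lt
          (t.le_max' _ (Finset.mem_insert_of_mem (Finset.mem_image_of_mem _ hx))) hc1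
    set V := Submodule.span ℂ ((s : Set H) ∪ A '' s) with hV
    have : FiniteDimensional ℂ V := FiniteDimensional.span_of_finite ℂ
      (s.finite_toSet.union (s.finite_toSet.image _))
    obtain ⟨e, he, he1, heq⟩ := exists_of_lt h_inf A hc2 V
    obtain ⟨g, hg, hg1, hgq⟩ := exists_of_lt h_inf (-A) (c := -c) (by linarith) V
    rw [qf_neg] at hgq
    obtain ⟨y, hy, hy1, hyq⟩ : ∃ y ∈ Vᗮ, ‖y‖ = 1 ∧ qf A y = c := by
      have hrank : 1 < Module.rank ℝ Vᗮ := by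
        rw [rank_real_of_complex]
        have : Nontrivial Vᗮ := ⟨⟨⟨e, he⟩, 0, by
          intro h
          have : e = 0 := congrArg Subtype.val h
          rw [this] at he1
          simp at he1⟩⟩
        have h1 : 1 ≤ Module.rank ℂ Vᗮ := Cardinal.one_le_iff_pos.2 rank_pos
        calc (1 : Cardinal) < 2 * 1 := by norm_num
          _ ≤ 2 * Module.rank ℂ Vᗮ := by gcongr
      have hpre := isPreconnected_sphere hrank (0 : Vᗮ) 1
      have hcont : ContinuousOn (fun v : Vᗮ => qf A v) (Metric.sphere 0 1) := by
        apply Continuous.continuousOn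
        unfold qf
        fun_prop
      have := hpre.intermediate_value (a := ⟨g, hg⟩) (b := ⟨e, he⟩) (by simpa using hg1)
        (by simpa using he1) hcont
      obtain ⟨y, hy, hyc⟩ := this (show c ∈ Set.Icc _ _ from ⟨by simp; linarith, heq.le⟩)
      exact ⟨y, y.2, by simpa using hy, hyc⟩
    refine ⟨y, ⟨hy1, by rw [hyq]; exact hc2⟩, fun x hx => ⟨?_, ?_, ?_⟩⟩
    · exact hy _ (Submodule.subset_span (Or.inl hx))
    · exact hy _ (Submodule.subset_span (Or.inr ⟨x, hx, rfl⟩))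
    · rw [hyq]; exact hc3 x hx)
  exact no_seq hT hAN f (fun n => (hf1 n).1) (fun m n h => (hf2 m n h).1)
    (fun m n h => (hf2 m n h).2.1) (fun m n h => (hf2 m n h).2.2)

theorem isUnit_pos [CompleteSpace H] {T : H →L[ℂ] H} (hT : T.IsPositive) {c : ℝ} (hc : 0 < c) :
    IsUnit (T + (c : ℂ) • 1) := by
  apply ContinuousLinearMap.isUnit_of_forall_le_norm_inner_map _ (c := ⟨c, hc.le⟩) (by exact hc)
  intro x
  refine le_trans ?_ (Complex.re_le_norm _)
  have h1 : (inner ℂ ((T + (c : ℂ) • 1) x) x).re = qf T x + c * ‖x‖ ^ 2 := by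
    have := qf_sub_smul T (-c) x
    rw [qf] at this
    simp only [Complex.ofReal_neg, neg_smul, sub_neg_eq_add] at this
    rw [this]; ring
  have h2 : 0 ≤ qf T x := hT.re_inner_nonneg_left x
  rw [h1]
  change ‖x‖ ^ 2 * c ≤ _
  linarith

theorem spec_nonneg [CompleteSpace H] {T : H →L[ℂ] H} (hT : T.IsPositive) {lam : ℝ}
    (h : (lam : ℂ) ∈ spectrum ℂ T) : 0 ≤ lam := by
  by_contra! hlt
  have := isUnit_pos hT (c := -lam) (by linarith)
  rw [spectrum.mem_iff, IsUnit.sub_iff] at h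
  apply h
  convert this using 1
  rw [Algebra.algebraMap_eq_smul_one]
  push_cast
  rw [neg_smul, sub_eq_add_neg]

theorem not_compact_one (h_inf : ¬ FiniteDimensional ℂ H) :
    ¬ IsCompactOperator (1 : H →L[ℂ] H) := fun h =>
  h_inf (FiniteDimensional.of_isCompactOperator_id (𝕜 := ℂ) (E := H) h)

theorem ess_eq [CompleteSpace H] (h_inf : ¬ FiniteDimensional ℂ H) {T : H →L[ℂ] H}
    (hT : T.IsPositive) {α : ℝ} (hα : 0 ≤ α)
    (hC : IsCompactOperator (T * T - ((α ^ 2 : ℝ) : ℂ) • 1 : H →L[ℂ] H)) :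
    essSpectrum T = {(α : ℂ)} := by
  set C : H →L[ℂ] H := T * T - ((α ^ 2 : ℝ) : ℂ) • 1 with hCdef
  ext lam
  simp only [essSpectrum, Set.mem_ofPred_eq, Set.mem_singleton_iff]
  constructor
  · intro h
    by_contra hne
    apply h
    by_cases hneg : lam = -(α : ℂ)
    · have hα0 : 0 < α := by
        rcases hα.lt_or_eq with h | h
        · exact h
        · exfalso; apply hne; rw [hneg, ← h]; simp
      obtain ⟨w, hw⟩ := isUnit_pos hT hα0
      have hw' : T - lam • 1 = (w : H →L[ℂ] H) := by
        rw [hw, hneg, neg_smul, sub_neg_eq_add]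
      refine ⟨((w⁻¹ : (H →L[ℂ] H)ˣ) : H →L[ℂ] H), ?_, ?_⟩
      · rw [hw', Units.inv_mul, sub_self]; exact isCompactOperator_zero
      · rw [hw', Units.mul_inv, sub_self]; exact isCompactOperator_zero
    · have hc : lam ^ 2 - (α : ℂ) ^ 2 ≠ 0 := by
        rw [sq_sub_sq]
        refine mul_ne_zero ?_ (sub_ne_zero.2 hne)
        intro h; exact hneg (eq_neg_of_add_eq_zero_left h)
      set c := lam ^ 2 - (α : ℂ) ^ 2 with hcdef
      have e1 : (T + lam • 1) * (T - lam • 1) = C - c • 1 := by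
        rw [hCdef, hcdef]
        ext x
        simp only [mul_apply_eq_comp, add_apply, sub_apply, smul_apply, one_apply_eq_self, map_sub,
          map_smul, Complex.ofReal_pow]
        module
      have e2 : (T - lam • 1) * (T + lam • 1) = C - c • 1 := by
        rw [hCdef, hcdef]
        ext x
        simp only [mul_apply_eq_comp, add_apply, sub_apply, smul_apply, one_apply_eq_self, map_add,
          map_smul, Complex.ofReal_pow]
        module
      have hk : IsCompactOperator (-((c⁻¹ : ℂ) • C) : H →L[ℂ] H) := (hC.smul c⁻¹).neg
      refine ⟨-(c⁻¹ : ℂ) • (T + lam • 1), ?_, ?_⟩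
      · convert hk using 2
        rw [smul_mul_assoc, e1, smul_sub, smul_smul, neg_mul, inv_mul_cancel₀ hc]
        simp
      · convert hk using 2
        rw [mul_smul_comm, e2, smul_sub, smul_smul, neg_mul, inv_mul_cancel₀ hc]
        simp
  · rintro rfl ⟨S, hS, -⟩
    set K : H →L[ℂ] H := S * (T - (α : ℂ) • 1) - 1 with hK
    have e2 : (T - (α : ℂ) • 1) * (T + (α : ℂ) • 1) = C := by
      rw [hCdef]
      ext x
      simp only [mul_apply_eq_comp, add_apply, sub_apply, smul_apply, one_apply_eq_self, map_add,
        map_smul, Complex.ofReal_pow]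
      module
    have e3 : T + (α : ℂ) • 1 = S * C - K * (T + (α : ℂ) • 1) := by
      rw [← e2, hK, sub_mul _ 1, one_mul, mul_assoc, sub_sub_cancel]
    have hcomp : IsCompactOperator (T + (α : ℂ) • 1 : H →L[ℂ] H) := by
      rw [e3]
      have c1 : IsCompactOperator (S * C : H →L[ℂ] H) := hC.clm_comp S
      have c2 : IsCompactOperator (K * (T + (α : ℂ) • 1) : H →L[ℂ] H) :=
        hS.comp_clm (T + (α : ℂ) • 1)
      exact c1.sub c2
    apply not_compact_one h_inf
    rcases hα.lt_or_eq with h | h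
    · obtain ⟨w, hw⟩ := isUnit_pos hT h
      have : IsCompactOperator
        (((w⁻¹ : (H →L[ℂ] H)ˣ) : H →L[ℂ] H) * (T + (α : ℂ) • 1) : H →L[ℂ] H) :=
        hcomp.clm_comp _
      rwa [← hw, Units.inv_mul] at this
    · have e4 : (1 : H →L[ℂ] H) = S * (T + (α : ℂ) • 1) - K := by
        rw [hK, ← h]; simp
      rw [e4]
      have c1 : IsCompactOperator (S * (T + (α : ℂ) • 1) : H →L[ℂ] H) := hcomp.clm_comp S
      exact c1.sub hS

theorem pos_apply_eq_zero {N : H →L[ℂ] H} (hN : N.IsPositive) {x : H} (h : qf N x = 0) :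
    N x = 0 := by
  have := cs_form N hN.isSymmetric ⊤ (fun y _ => hN.re_inner_nonneg_left y) x (N x) trivial trivial
  have hre : (inner ℂ (N x) (N x)).re = ‖N x‖ ^ 2 := by
    rw [inner_self_eq_norm_sq_to_K]; simp [← Complex.ofReal_pow]
  rw [h, zero_mul, hre] at this
  have h2 := le_antisymm this (by positivity)
  simpa using h2

theorem finite_below [CompleteSpace H] {T : H →L[ℂ] H}
    (hT : T.IsPositive) (hAN : IsAbsNormAttaining T) {α : ℝ} (hα : 0 ≤ α)
    (hC : IsCompactOperator (T * T - ((α ^ 2 : ℝ) : ℂ) • 1 : H →L[ℂ] H)) :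
    {lam : ℝ | (lam : ℂ) ∈ spectrum ℂ T ∧ lam < α}.Finite := by
  rcases hα.eq_or_lt with h0 | hα0
  · convert Set.finite_empty
    ext lam
    simp only [Set.mem_ofPred_eq, Set.mem_empty_iff_false, iff_false, not_and, not_lt]
    intro h
    rw [← h0]
    exact spec_nonneg hT h
  set C : H →L[ℂ] H := T * T - ((α ^ 2 : ℝ) : ℂ) • 1 with hCdef
  have hTs := hT.isSymmetric
  have hqC : ∀ x, qf C x = ‖T x‖ ^ 2 - α ^ 2 * ‖x‖ ^ 2 := by
    intro x
    rw [hCdef, qf_sub_smul, qf_sq hTs]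
  have hCs : (C : H →ₗ[ℂ] H).IsSymmetric := by
    intro a b
    have := sq_symm hTs a b
    simp only [ContinuousLinearMap.coe_coe] at this
    simp only [hCdef, ContinuousLinearMap.coe_coe, sub_apply, smul_apply, one_apply_eq_self,
      inner_sub_left, inner_sub_right, inner_smul_left, inner_smul_right, this,
      Complex.conj_ofReal]
  have hCsa : IsSelfAdjoint C := ContinuousLinearMap.isSelfAdjoint_iff_isSymmetric.2 hCs
  set N := C⁻ with hN
  set P := C⁺ with hP
  have hPN : P - N = C := CFC.posPart_sub_negPart C
  have hPN0 : P * N = 0 := CFC.posPart_mul_negPart C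
  have hNP0 : N * P = 0 := CFC.negPart_mul_posPart C
  have hNpos : N.IsPositive :=
    (ContinuousLinearMap.nonneg_iff_isPositive _).1 (CFC.negPart_nonneg C)
  have hPpos : P.IsPositive :=
    (ContinuousLinearMap.nonneg_iff_isPositive _).1 (CFC.posPart_nonneg C)
  set M := (LinearMap.ker (N : H →ₗ[ℂ] H))ᗮ with hM
  have hMneg : ∀ x ∈ M, 0 ≤ qf C x → x = 0 := by
    intro x hx hq
    have hPx : inner ℂ (P x) x = 0 := by
      apply hx
      have : (N * P) x = 0 := by rw [hNP0]; rfl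
      exact this
    have h1 : qf C x = - qf N x := by
      rw [← hPN]
      simp [qf, inner_sub_left, hPx]
    have h2 : 0 ≤ qf N x := hNpos.re_inner_nonneg_left x
    have h3 : N x = 0 := pos_apply_eq_zero hNpos (by linarith)
    have h4 : inner ℂ x x = 0 := hx x h3
    exact inner_self_eq_zero.1 h4
  have hMfd : FiniteDimensional ℂ M := by
    by_contra hMinf
    have hM0 : M ≠ ⊥ := by
      intro h
      apply hMinf
      rw [h]
      infer_instance
    obtain ⟨x₀, hx₀, hx₀1, hmax⟩ := an_max hAN M (Submodule.isClosed_orthogonal _) hM0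
    have hge : α ^ 2 ≤ ‖T x₀‖ ^ 2 := by
      apply le_of_forall_pos_le_add
      intro ε hε
      obtain ⟨V, hV, hVs⟩ := compact_small C hC ε hε
      obtain ⟨x, hxM, hxV, hx1⟩ := exists_unit M V hMinf
      have h1 := hmax x hxM hx1.le
      have h2 := hVs x hxV
      have h3 : -qf C x ≤ ‖C x‖ * ‖x‖ := by
        refine le_trans (neg_le_abs _) ?_
        exact (Complex.abs_re_le_norm _).trans (norm_inner_le_norm _ _)
      rw [hqC, hx1] at h3
      rw [hx1] at h2
      have h4 : ‖T x‖ ^ 2 ≤ ‖T x₀‖ ^ 2 := by gcongr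
      linarith
    have hz : x₀ = 0 := by
      apply hMneg x₀ hx₀
      rw [hqC]
      have : ‖x₀‖ ^ 2 ≤ 1 := by nlinarith [norm_nonneg x₀]
      nlinarith [sq_nonneg α]
    rw [hz] at hge
    simp at hge
    exact absurd hge hα0.ne'
  have hNM : ∀ x, N x ∈ M := by
    intro x y hy
    have h1 : inner ℂ (N y) x = inner ℂ y (N x) := hNpos.isSymmetric y x
    have h2 : N y = 0 := hy
    rw [← h1, h2, inner_zero_left]
  set NM : Module.End ℂ M := (N : H →ₗ[ℂ] H).restrict (p := M) (q := M) (fun x _ => hNM x)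
    with hNMdef
  refine Set.Finite.of_injOn (f := fun lam : ℝ => ((α ^ 2 - lam ^ 2 : ℝ) : ℂ))
    (t := {μ | NM.HasEigenvalue μ}) ?_ ?_ NM.finite_hasEigenvalue
  · rintro lam ⟨hlam, hlt⟩
    have hlam0 := spec_nonneg hT hlam
    set μ : ℝ := lam ^ 2 - α ^ 2 with hμ
    have hμneg : μ < 0 := by rw [hμ]; nlinarith
    have hμspec : (μ : ℂ) ∈ spectrum ℂ C := by
      rw [spectrum.mem_iff, IsUnit.sub_iff] at hlam ⊢
      intro hu
      apply hlam
      rw [Algebra.algebraMap_eq_smul_one] at hu ⊢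
      have e1 : (T + (lam : ℂ) • 1) * (T - (lam : ℂ) • 1) = C - (μ : ℂ) • 1 := by
        rw [hCdef, hμ]
        ext x
        simp only [mul_apply_eq_comp, add_apply, sub_apply, smul_apply, one_apply_eq_self, map_sub,
          map_smul, Complex.ofReal_pow, Complex.ofReal_sub]
        module
      have e2 : (T - (lam : ℂ) • 1) * (T + (lam : ℂ) • 1) = C - (μ : ℂ) • 1 := by
        rw [hCdef, hμ]
        ext x
        simp only [mul_apply_eq_comp, add_apply, sub_apply, smul_apply, one_apply_eq_self, map_add,
          map_smul, Complex.ofReal_pow, Complex.ofReal_sub]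
        module
      have hcomm : Commute (T + (lam : ℂ) • 1) (T - (lam : ℂ) • 1) := e1.trans e2.symm
      rw [← e1, hcomm.isUnit_mul_iff] at hu
      exact hu.2
    have hμ0 : (μ : ℂ) ≠ 0 := by exact_mod_cast hμneg.ne
    have hev := (IsCompactOperator.hasEigenvalue_iff_mem_spectrum hC hμ0).2 hμspec
    obtain ⟨x, hx⟩ := hev.exists_hasEigenvector
    have hCx : C x = (μ : ℂ) • x := hx.apply_eq_smul
    have hPx : P x = 0 := by
      have h1 : P (P x) = (μ : ℂ) • P x := by
        rw [← map_smul, ← hCx, ← hPN]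
        have : P (N x) = 0 := by
          have h : (P * N) x = 0 := by rw [hPN0]; rfl
          exact h
        simp [this]
      have h2 : 0 ≤ qf P (P x) := hPpos.re_inner_nonneg_left _
      have h3 : qf P (P x) = μ * ‖P x‖ ^ 2 := by
        rw [qf, h1, inner_smul_left, Complex.conj_ofReal, Complex.re_ofReal_mul,
          inner_self_eq_norm_sq_to_K]
        simp [← Complex.ofReal_pow]
      rw [h3] at h2
      have h4 : ‖P x‖ ^ 2 ≤ 0 := by nlinarith
      have h5 := le_antisymm h4 (sq_nonneg _)
      simpa using h5
    have hNx : N x = ((α ^ 2 - lam ^ 2 : ℝ) : ℂ) • x := by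
      have : C x = P x - N x := by rw [← hPN]; rfl
      rw [hCx, hPx, zero_sub] at this
      rw [eq_neg_iff_add_eq_zero, add_comm, ← eq_neg_iff_add_eq_zero] at this
      rw [this, ← neg_smul, hμ]
      congr 1
      push_cast; ring
    have hxM : x ∈ M := by
      have : x = ((α ^ 2 - lam ^ 2 : ℝ) : ℂ)⁻¹ • N x := by
        rw [hNx, smul_smul, inv_mul_cancel₀, one_smul]
        rw [Complex.ofReal_ne_zero]
        rw [hμ] at hμneg
        linarith
      rw [this]
      exact M.smul_mem _ (hNM x)
    apply Module.End.hasEigenvalue_of_hasEigenvector (x := ⟨x, hxM⟩)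
    rw [Module.End.hasEigenvector_iff, Module.End.mem_eigenspace_iff]
    refine ⟨Subtype.ext hNx, fun h => hx.2 (congrArg Subtype.val h)⟩
  · rintro a ⟨ha, -⟩ b ⟨hb, -⟩ hab
    have ha0 := spec_nonneg hT ha
    have hb0 := spec_nonneg hT hb
    have : α ^ 2 - a ^ 2 = α ^ 2 - b ^ 2 := Complex.ofReal_injective hab
    exact (sq_eq_sq₀ ha0 hb0).1 (by linarith)

theorem forward [CompleteSpace H] (h_inf : ¬ FiniteDimensional ℂ H) (T : H →L[ℂ] H)
    (hT : T.IsPositive) (hAN : IsAbsNormAttaining T) :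
    ∃ α : ℝ, 0 ≤ α ∧ essSpectrum T = {(α : ℂ)} ∧
        {lam : ℝ | (lam : ℂ) ∈ spectrum ℂ T ∧ lam < α}.Finite := by
  have hcol := an_collapse h_inf hT.isSymmetric hAN
  have h0 : 0 ≤ eu (T * T) := by
    by_contra! hlt
    obtain ⟨V, hV, h⟩ := EB_of_gt (T * T) hlt
    obtain ⟨x, -, hx1, hx2⟩ := exists_of_lt h_inf (-(T * T)) (c := 0) (by rw [hcol]; linarith) ⊥
    rw [qf_neg, qf_sq hT.isSymmetric] at hx2
    linarith [sq_nonneg ‖T x‖]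
  have hC := compact_of_collapse (T * T) (sq_symm hT.isSymmetric) _ rfl hcol
  rw [← Real.sq_sqrt h0] at hC
  exact ⟨√(eu (T * T)), Real.sqrt_nonneg _, ess_eq h_inf hT (Real.sqrt_nonneg _) hC,
    finite_below hT hAN (Real.sqrt_nonneg _) hC⟩

theorem ess_compact [CompleteSpace H] (h_inf : ¬ FiniteDimensional ℂ H) {T : H →L[ℂ] H}
    (hT : T.IsPositive) {α : ℝ} (hess : essSpectrum T = {(α : ℂ)}) :
    IsCompactOperator (T - (α : ℂ) • 1 : H →L[ℂ] H) := by
  have h1 : (eu T : ℂ) ∈ essSpectrum T := by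
    rintro ⟨S, hS, -⟩
    exact not_left_inv h_inf T hT.isSymmetric S hS
  have h2 : ((-eu (-T) : ℝ) : ℂ) ∈ essSpectrum T := by
    rintro ⟨S, hS, -⟩
    have hneg : ((-T : H →L[ℂ] H) : H →ₗ[ℂ] H).IsSymmetric := by
      intro a b
      have := hT.isSymmetric a b
      simp only [ContinuousLinearMap.coe_coe] at this
      simp only [ContinuousLinearMap.coe_coe, neg_apply, inner_neg_left, inner_neg_right, this]
    apply not_left_inv h_inf (-T) hneg (-S)
    convert hS using 2
    push_cast
    rw [neg_mul, ← mul_neg, neg_sub, neg_smul, sub_neg_eq_add, sub_neg_eq_add, add_comm]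
  rw [hess, Set.mem_singleton_iff] at h1 h2
  have h1' := Complex.ofReal_injective h1
  have h2' := Complex.ofReal_injective h2
  exact compact_of_collapse T hT.isSymmetric α h1' (by linarith)

theorem sq_compact {T : H →L[ℂ] H} {α : ℝ}
    (hD : IsCompactOperator (T - (α : ℂ) • 1 : H →L[ℂ] H)) :
    IsCompactOperator (T * T - ((α ^ 2 : ℝ) : ℂ) • 1 : H →L[ℂ] H) := by
  have e1 : T * T - ((α ^ 2 : ℝ) : ℂ) • 1 = (T + (α : ℂ) • 1) * (T - (α : ℂ) • 1) := by
    ext x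
    simp only [mul_apply_eq_comp, add_apply, sub_apply, smul_apply, one_apply_eq_self, map_sub,
      map_smul, Complex.ofReal_pow]
    module
  rw [e1]
  exact hD.clm_comp (T + (α : ℂ) • 1)

theorem gap {T : H →L[ℂ] H} {α : ℝ}
    (hfin : {lam : ℝ | (lam : ℂ) ∈ spectrum ℂ T ∧ lam < α}.Finite) :
    ∃ δ > 0, ∀ lam : ℝ, (lam : ℂ) ∈ spectrum ℂ T → lam < α → lam ≤ α - δ := by
  rcases Set.eq_empty_or_nonempty {lam : ℝ | (lam : ℂ) ∈ spectrum ℂ T ∧ lam < α} with h | h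
  · refine ⟨1, one_pos, fun lam h1 h2 => ?_⟩
    have : lam ∈ (∅ : Set ℝ) := h ▸ (show lam ∈ {lam : ℝ | (lam : ℂ) ∈ spectrum ℂ T ∧ lam < α} from ⟨h1, h2⟩)
    exact absurd this (by simp)
  · obtain ⟨m, hm, hmax⟩ := hfin.exists_maximalFor id _ h
    refine ⟨α - m, sub_pos.2 hm.2, fun lam h1 h2 => ?_⟩
    rcases le_total lam m with h3 | h3
    · linarith
    · have := hmax (j := lam) ⟨h1, h2⟩ h3
      simp only [id] at this
      linarith

theorem fd_of_compact_idem {E : H →L[ℂ] H} (hE : IsCompactOperator E) (hidem : E * E = E) :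
    FiniteDimensional ℂ (LinearMap.range (E : H →ₗ[ℂ] H)) := by
  have hr : LinearMap.range (E : H →ₗ[ℂ] H) = LinearMap.ker ((1 - E : H →L[ℂ] H) : H →ₗ[ℂ] H) := by
    ext x
    constructor
    · rintro ⟨y, rfl⟩
      have : (E * E) y = E y := by rw [hidem]
      simp only [mul_apply_eq_comp] at this
      simp [this]
    · intro hx
      refine ⟨x, ?_⟩
      have h : x - E x = 0 := hx
      exact (sub_eq_zero.1 h).symm
  have hcl : IsClosed (LinearMap.range (E : H →ₗ[ℂ] H) : Set H) := by
    rw [hr]; exact (1 - E).isClosed_ker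
  have hmap : ∀ x ∈ LinearMap.range (E : H →ₗ[ℂ] H),
      (E : H →ₗ[ℂ] H) x ∈ LinearMap.range (E : H →ₗ[ℂ] H) := fun x _ => ⟨x, rfl⟩
  have := IsCompactOperator.restrict (f := (E : H →ₗ[ℂ] H)) hE hmap hcl
  apply FiniteDimensional.of_isCompactOperator_id (𝕜 := ℂ)
  refine (congrArg IsCompactOperator (funext ?_)).mp this
  rintro ⟨x, y, rfl⟩
  have : (E * E) y = E y := by rw [hidem]
  exact Subtype.ext this

theorem exists_V [CompleteSpace H] {T : H →L[ℂ] H} (hT : T.IsPositive) {α : ℝ} (hα : 0 ≤ α)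
    (hD : IsCompactOperator (T - (α : ℂ) • 1 : H →L[ℂ] H))
    (hfin : {lam : ℝ | (lam : ℂ) ∈ spectrum ℂ T ∧ lam < α}.Finite) :
    ∃ V : Submodule ℂ H, FiniteDimensional ℂ V ∧ ∀ x ∈ Vᗮ, α * ‖x‖ ≤ ‖T x‖ := by
  obtain ⟨δ, hδ, hgap⟩ := gap hfin
  have hsa : IsSelfAdjoint T := hT.isSelfAdjoint
  have hspec : ∀ t ∈ spectrum ℝ T, 0 ≤ t ∧ (t < α → t ≤ α - δ) := by
    intro t ht
    have h : (t : ℂ) ∈ spectrum ℂ T := (spectrum.algebraMap_mem_iff ℂ (r := t)).2 ht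
    exact ⟨spec_nonneg hT h, hgap t h⟩
  set k : ℝ → ℝ := fun t => -(min 1 (max (α - t) 0 / δ)) / max (α - t) δ with hk
  have hkc : Continuous k := by
    apply Continuous.div
    · fun_prop
    · fun_prop
    · intro t; exact (lt_of_lt_of_le hδ (le_max_right _ _)).ne'
  set h : ℝ → ℝ := fun t => (t - α) * k t with hh
  have hhc : Continuous h := by fun_prop
  have hlow : ∀ t, t ≤ α - δ → h t = 1 := by
    intro t ht
    have h1 : max (α - t) 0 = α - t := max_eq_left (by linarith)
    have h2 : max (α - t) δ = α - t := max_eq_left (by linarith)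
    have h3 : min 1 ((α - t) / δ) = 1 := min_eq_left (by rw [le_div_iff₀ hδ]; linarith)
    simp only [hh, hk, h1, h2, h3]
    have : α - t ≠ 0 := by linarith
    field_simp
    ring
  have hhigh : ∀ t, α ≤ t → h t = 0 := by
    intro t ht
    have h1 : max (α - t) 0 = 0 := max_eq_right (by linarith)
    simp [hh, hk, h1]
  set E : H →L[ℂ] H := cfc h T with hE
  have hEk : E = (T - (α : ℂ) • 1) * cfc k T := by
    rw [hE, hh, cfc_mul (fun t => t - α) k T (by fun_prop) hkc.continuousOn, cfc_sub _ _ T, cfc_id' ℝ T,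
      cfc_const α T]
    congr 2
  have hEc : IsCompactOperator E := by rw [hEk]; exact hD.comp_clm (cfc k T)
  have hEE : E * E = E := by
    rw [hE, ← cfc_mul h h T hhc.continuousOn hhc.continuousOn]
    apply cfc_congr
    intro t ht
    rcases lt_or_ge t α with h1 | h1
    · simp [hlow t ((hspec t ht).2 h1)]
    · simp [hhigh t h1]
  have hEsa : IsSelfAdjoint E := cfc_predicate h T
  refine ⟨_, fd_of_compact_idem hEc hEE, fun x hx => ?_⟩
  have hEx : E x = 0 := by
    have h1 : inner ℂ (E (E x)) x = 0 := hx _ ⟨E x, rfl⟩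
    have h2 : inner ℂ (E (E x)) x = inner ℂ (E x) (E x) :=
      (ContinuousLinearMap.isSelfAdjoint_iff_isSymmetric.1 hEsa) (E x) x
    rw [h2] at h1
    exact inner_self_eq_zero.1 h1
  have hpos : 0 ≤ (T * T - ((α ^ 2 : ℝ) : ℂ) • 1) * (1 - E) := by
    have e : (T * T - ((α ^ 2 : ℝ) : ℂ) • 1) * (1 - E)
        = cfc (fun t => (t * t - α ^ 2) * (1 - h t)) T := by
      rw [cfc_mul (fun t => t * t - α ^ 2) (fun t => 1 - h t) T (by fun_prop) (by fun_prop),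
        cfc_sub (fun t => t * t) (fun _ => α ^ 2) T (by fun_prop) (by fun_prop),
        cfc_mul (fun t => t) (fun t => t) T (by fun_prop) (by fun_prop),
        cfc_sub (fun _ => 1) h T (by fun_prop) hhc.continuousOn, cfc_id' ℝ T, cfc_const _ T,
        cfc_const_one ℝ T]
      congr 2
    rw [e]
    apply cfc_nonneg
    intro t ht
    obtain ⟨h0, h1⟩ := hspec t ht
    rcases lt_or_ge t α with h2 | h2
    · simp [hlow t (h1 h2)]
    · rw [hhigh t h2]; nlinarith
  rw [ContinuousLinearMap.nonneg_iff_isPositive] at hpos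
  have h1 := hpos.re_inner_nonneg_left x
  have h2 : ((T * T - ((α ^ 2 : ℝ) : ℂ) • 1) * (1 - E)) x = (T * T - ((α ^ 2 : ℝ) : ℂ) • 1) x := by
    rw [mul_apply_eq_comp, sub_apply 1, hEx, sub_zero, one_apply_eq_self]
  rw [h2] at h1
  have h3 : 0 ≤ qf (T * T - ((α ^ 2 : ℝ) : ℂ) • 1) x := h1
  rw [qf_sub_smul, qf_sq hT.isSymmetric] at h3
  rw [← pow_le_pow_iff_left₀ (by positivity) (norm_nonneg _) two_ne_zero]
  nlinarith

theorem max_of_gt [CompleteSpace H] {T : H →L[ℂ] H} (hT : T.IsPositive) {α : ℝ} (hα : 0 ≤ α)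
    (hC : IsCompactOperator (T * T - ((α ^ 2 : ℝ) : ℂ) • 1 : H →L[ℂ] H))
    (M : Submodule ℂ H) (hM : IsClosed (M : Set H)) (y : H) (hy : y ∈ M)
    (hgt : α * ‖y‖ < ‖T y‖) :
    ∃ x₀ ∈ M, ‖x₀‖ ≤ 1 ∧ ∀ x ∈ M, ‖x‖ ≤ 1 → ‖T x‖ ≤ ‖T x₀‖ := by
  have : CompleteSpace M := hM.completeSpace_coe
  have hy0 : y ≠ 0 := by rintro rfl; simp at hgt
  have : Nontrivial M := ⟨⟨y, hy⟩, 0, fun h => hy0 (congrArg Subtype.val h)⟩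
  set B : M →L[ℂ] M := M.orthogonalProjectionOnto ∘L (T * T) ∘L M.subtypeL with hB
  have hBi : ∀ x z : M, inner ℂ (B x) z = inner ℂ (T x) (T z) := by
    intro x z
    have h1 : inner ℂ (B x) z = inner ℂ ((T * T) (x : H)) (z : H) := by
      simp [hB]
    rw [h1]
    exact hT.isSymmetric _ _
  have hBpos : B.IsPositive := by
    rw [ContinuousLinearMap.isPositive_iff_complex]
    intro x
    rw [hBi, inner_self_eq_norm_sq_to_K]
    simp [← Complex.ofReal_pow]
  have hBx : ∀ x : M, ‖T x‖ ^ 2 ≤ ‖B‖ * ‖x‖ ^ 2 := by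
    intro x
    have h1 : (inner ℂ (B x) x).re = ‖T x‖ ^ 2 := by
      rw [hBi, inner_self_eq_norm_sq_to_K]; simp [← Complex.ofReal_pow]
    rw [← h1]
    calc _ ≤ ‖B x‖ * ‖x‖ := (Complex.re_le_norm _).trans (norm_inner_le_norm _ _)
      _ ≤ ‖B‖ * ‖x‖ * ‖x‖ := by gcongr; exact B.le_opNorm x
      _ = _ := by ring
  have hBgt : α ^ 2 < ‖B‖ := by
    have h1 := hBx ⟨y, hy⟩
    have h2 : (α * ‖y‖) ^ 2 < ‖T y‖ ^ 2 := by gcongr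
    have h3 : 0 < ‖y‖ ^ 2 := by positivity
    have h4 : ‖(⟨y, hy⟩ : M)‖ = ‖y‖ := rfl
    rw [h4] at h1
    simp only at h1
    rw [mul_pow] at h2
    exact lt_of_mul_lt_mul_right (h2.trans_le h1) h3.le
  have hspec : (‖B‖ : ℂ) ∈ spectrum ℂ B := by
    have := CStarAlgebra.norm_mem_spectrum_of_nonneg (a := B)
      ((ContinuousLinearMap.nonneg_iff_isPositive _).2 hBpos)
    exact (spectrum.algebraMap_mem_iff ℂ (r := ‖B‖)).2 this
  set CM : M →L[ℂ] M := B - ((α ^ 2 : ℝ) : ℂ) • 1 with hCM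
  have hCMc : IsCompactOperator CM := by
    have e : CM = M.orthogonalProjectionOnto ∘L (T * T - ((α ^ 2 : ℝ) : ℂ) • 1) ∘L M.subtypeL := by
      rw [hCM, hB]
      ext x
      simp only [ContinuousLinearMap.comp_apply, sub_apply, smul_apply, one_apply_eq_self,
        Submodule.subtypeL_apply, map_sub, map_smul,
        Submodule.orthogonalProjectionOnto_mem_subspace_eq_self]
    rw [e]
    exact (hC.comp_clm M.subtypeL).clm_comp M.orthogonalProjectionOnto
  have hspec2 : ((‖B‖ - α ^ 2 : ℝ) : ℂ) ∈ spectrum ℂ CM := by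
    rw [spectrum.mem_iff] at hspec ⊢
    convert hspec using 2
    rw [hCM, Algebra.algebraMap_eq_smul_one, Algebra.algebraMap_eq_smul_one, Complex.ofReal_sub,
      sub_smul]
    abel
  have hne : ((‖B‖ - α ^ 2 : ℝ) : ℂ) ≠ 0 := by
    rw [Complex.ofReal_ne_zero]; linarith
  obtain ⟨v, hv⟩ := ((IsCompactOperator.hasEigenvalue_iff_mem_spectrum hCMc hne).2
    hspec2).exists_hasEigenvector
  have hv0 : v ≠ 0 := hv.2
  have hCv : CM v = ((‖B‖ - α ^ 2 : ℝ) : ℂ) • v := hv.apply_eq_smul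
  have hBv : B v = (‖B‖ : ℂ) • v := by
    have : B v = CM v + ((α ^ 2 : ℝ) : ℂ) • v := by
      rw [hCM, sub_apply, smul_apply, one_apply_eq_self, sub_add_cancel]
    rw [this, hCv, ← add_smul, Complex.ofReal_sub, sub_add_cancel]
  have hTv : ‖T v‖ ^ 2 = ‖B‖ * ‖v‖ ^ 2 := by
    have h1 := congrArg Complex.re (hBi v v)
    rw [hBv, inner_smul_left, Complex.conj_ofReal, Complex.re_ofReal_mul,
      inner_self_eq_norm_sq_to_K, inner_self_eq_norm_sq_to_K] at h1
    simp [← Complex.ofReal_pow] at h1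
    simpa using h1.symm
  have hvn : 0 < ‖v‖ := norm_pos_iff.2 hv0
  refine ⟨((‖v‖ : ℂ)⁻¹) • (v : H), M.smul_mem _ v.2, ?_, fun x hx hx1 => ?_⟩
  · rw [norm_smul, norm_inv, Complex.norm_real, norm_norm, Submodule.coe_norm,
      inv_mul_cancel₀ (by simpa using hv0)]
  · rw [← pow_le_pow_iff_left₀ (norm_nonneg _) (norm_nonneg _) two_ne_zero]
    have h1 := hBx ⟨x, hx⟩
    have h4 : ‖(⟨x, hx⟩ : M)‖ = ‖x‖ := rfl
    rw [h4] at h1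
    simp only at h1
    rw [map_smul, norm_smul, norm_inv, Complex.norm_real, norm_norm, mul_pow, hTv]
    have h5 : (‖v‖⁻¹) ^ 2 * (‖B‖ * ‖v‖ ^ 2) = ‖B‖ := by field_simp
    rw [h5]
    have : ‖x‖ ^ 2 ≤ 1 := by nlinarith [norm_nonneg x]
    nlinarith [norm_nonneg B]

theorem max_of_fd {T : H →L[ℂ] H} (M : Submodule ℂ H) [FiniteDimensional ℂ M] :
    ∃ x₀ ∈ M, ‖x₀‖ ≤ 1 ∧ ∀ x ∈ M, ‖x‖ ≤ 1 → ‖T x‖ ≤ ‖T x₀‖ := by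
  have : ProperSpace M := FiniteDimensional.proper ℂ M
  obtain ⟨x₀, h1, h2⟩ := (isCompact_closedBall (0 : M) 1).exists_isMaxOn ⟨0, by simp⟩
    (f := fun x : M => ‖T x‖) (by fun_prop)
  refine ⟨x₀, x₀.2, by simpa using h1, fun x hx hx1 => ?_⟩
  exact h2 (a := ⟨x, hx⟩) (by simpa using hx1)

theorem backward [CompleteSpace H] (h_inf : ¬ FiniteDimensional ℂ H) (T : H →L[ℂ] H)
    (hT : T.IsPositive) {α : ℝ} (hα : 0 ≤ α) (hess : essSpectrum T = {(α : ℂ)})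
    (hfin : {lam : ℝ | (lam : ℂ) ∈ spectrum ℂ T ∧ lam < α}.Finite) : IsAbsNormAttaining T := by
  have hD := ess_compact h_inf hT hess
  have hC := sq_compact hD
  obtain ⟨V, hV, hVT⟩ := exists_V hT hα hD hfin
  apply an_of_max
  intro M hM _
  by_cases hfd : FiniteDimensional ℂ M
  · exact max_of_fd M
  by_cases hle : ∀ x ∈ M, ‖T x‖ ≤ α * ‖x‖
  · obtain ⟨x, hxM, hxV, hx1⟩ := exists_unit M V hfd
    refine ⟨x, hxM, hx1.le, fun z hz hz1 => ?_⟩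
    have h1 := hle z hz
    have h2 := hVT x hxV
    rw [hx1] at h2
    nlinarith
  · push Not at hle
    obtain ⟨y, hy, hgt⟩ := hle
    exact max_of_gt hT hα hC M hM y hy hgt

end ANProof


/-- A positive operator on an infinite-dimensional complex Hilbert space is absolutely norm
attaining iff its essential spectrum is a singleton `{α}` with `α ≥ 0` and the spectrum
contains only finitely many elements strictly less than `α`. -/
theorem positive_isAbsNormAttaining_iff
    {H : Type*} [NormedAddCommGroup H] [InnerProductSpace ℂ H] [CompleteSpace H]
    (h_inf : ¬ FiniteDimensional ℂ H) (T : H →L[ℂ] H) (hT : T.IsPositive) :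
    IsAbsNormAttaining T ↔
      ∃ α : ℝ, 0 ≤ α ∧ essSpectrum T = {(α : ℂ)} ∧
        {lam : ℝ | (lam : ℂ) ∈ spectrum ℂ T ∧ lam < α}.Finite := by
  constructor
  · exact ANProof.forward h_inf T hT
  · rintro ⟨α, hα, hess, hfin⟩
    exact ANProof.backward h_inf T hT hα hess hfin
end

section
/- Let H be an infinite-dimensional complex Hilbert space and let T be a positive bounded linear operator on H. If T is absolutely norm attaining, then there exists α ≥ 0 such that the essential spectrum of T equals {α} and the spectrum σ(T) contains only finitely many elements strictly less than α. -/
section helpers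

variable {H : Type*} [NormedAddCommGroup H] [InnerProductSpace ℂ H]

/-- Norm attainment on a closed subspace, in a convenient form. -/
lemma an_exists_max {T : H →L[ℂ] H} (hAN : IsAbsNormAttaining T) (M : Submodule ℂ H)
    (hM : IsClosed (M : Set H)) (hne : M ≠ ⊥) :
    ∃ y ∈ M, ‖y‖ = 1 ∧ ∀ z ∈ M, ‖T z‖ ≤ ‖T y‖ * ‖z‖ := by
  obtain ⟨x, hxM, hx1, hx⟩ := hAN M hM hne
  have hb : BddAbove ((fun x => ‖T x‖) '' {x : H | x ∈ M ∧ ‖x‖ ≤ 1}) := by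
    refine ⟨‖T‖, ?_⟩
    rintro _ ⟨z, ⟨_, hz⟩, rfl⟩
    exact (T.le_opNorm z).trans (mul_le_of_le_one_right (norm_nonneg _) hz)
  have key : ∀ z ∈ M, ‖T z‖ ≤ ‖T x‖ * ‖z‖ := by
    intro z hz
    by_cases h0 : z = 0
    · simp [h0]
    have hz0 : 0 < ‖z‖ := norm_pos_iff.2 h0
    have h1 : ‖T (((‖z‖⁻¹ : ℝ) : ℂ) • z)‖ ≤ ‖T x‖ := by
      rw [hx]
      refine le_csSup hb ⟨_, ⟨M.smul_mem _ hz, ?_⟩, rfl⟩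
      rw [norm_smul, Complex.norm_real, norm_inv, norm_norm, inv_mul_cancel₀ hz0.ne']
    rw [map_smul, norm_smul, Complex.norm_real, norm_inv, norm_norm, inv_mul_le_iff₀ hz0] at h1
    linarith
  by_cases h0 : T x = 0
  · obtain ⟨z, hz, hz0⟩ := M.ne_bot_iff.1 hne
    have hz0' : 0 < ‖z‖ := norm_pos_iff.2 hz0
    refine ⟨((‖z‖⁻¹ : ℝ) : ℂ) • z, M.smul_mem _ hz, ?_, ?_⟩
    · rw [norm_smul, Complex.norm_real, norm_inv, norm_norm, inv_mul_cancel₀ hz0'.ne']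
    · intro w hw
      have := key w hw
      rw [h0, norm_zero, zero_mul] at this
      exact this.trans (by positivity)
  · have h2 := key x hxM
    have h3 : 0 < ‖T x‖ := norm_pos_iff.2 h0
    refine ⟨x, hxM, le_antisymm hx1 ?_, key⟩
    by_contra hlt
    push Not at hlt
    nlinarith

/-- First variation at a maximizer. -/
lemma max_variation {T : H →L[ℂ] H} {M : Submodule ℂ H} {y : H} (hy : y ∈ M) (hy1 : ‖y‖ = 1)
    (hmax : ∀ z ∈ M, ‖T z‖ ≤ ‖T y‖ * ‖z‖) (z : H) (hz : z ∈ M) :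
    inner ℂ (T y) (T z) = ((‖T y‖ ^ 2 : ℝ) : ℂ) * inner ℂ y z := by
  have re_eq : ∀ z ∈ M, RCLike.re (inner ℂ (T y) (T z)) = ‖T y‖ ^ 2 * RCLike.re (inner ℂ y z) := by
    intro z hz
    have hq : ∀ r : ℝ, 0 ≤ r * (2 * (‖T y‖ ^ 2 * RCLike.re (inner ℂ y z)
        - RCLike.re (inner ℂ (T y) (T z)))) + r ^ 2 * (‖T y‖ ^ 2 * ‖z‖ ^ 2 - ‖T z‖ ^ 2) := by
      intro r
      have h1 := hmax (y + (r : ℂ) • z) (M.add_mem hy (M.smul_mem _ hz))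
      have h2 := pow_le_pow_left₀ (norm_nonneg _) h1 2
      rw [mul_pow, map_add, map_smul, @norm_add_sq ℂ, @norm_add_sq ℂ, inner_smul_right,
        inner_smul_right, norm_smul, norm_smul, mul_pow, mul_pow, hy1, Complex.norm_real,
        Real.norm_eq_abs, sq_abs] at h2
      simp only [RCLike.re_to_complex, Complex.re_ofReal_mul] at h2 ⊢
      nlinarith
    set B := 2 * (‖T y‖ ^ 2 * RCLike.re (inner ℂ y z) - RCLike.re (inner ℂ (T y) (T z))) with hB
    set C := ‖T y‖ ^ 2 * ‖z‖ ^ 2 - ‖T z‖ ^ 2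
    have hC : 0 ≤ C := by nlinarith [hq 1, hq (-1)]
    have : B = 0 := by
      by_contra hB0
      have h := hq (-B / (C + 1))
      have h5 : -B / (C + 1) * B + (-B / (C + 1)) ^ 2 * C = - (B ^ 2 / (C + 1) ^ 2) := by
        field_simp
        ring
      rw [h5] at h
      have : 0 < B ^ 2 / (C + 1) ^ 2 := by positivity
      linarith
    linarith
  apply Complex.ext
  · have := re_eq z hz
    rw [Complex.re_ofReal_mul]
    exact this
  · have := re_eq (Complex.I • z) (M.smul_mem _ hz)
    rw [map_smul, inner_smul_right, inner_smul_right] at this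
    simp only [RCLike.re_to_complex, Complex.mul_re, Complex.I_re, Complex.I_im] at this
    rw [Complex.im_ofReal_mul]
    linarith

/-- An orthonormal family on which `T` keeps orthogonality cannot have unattained supremum. -/
lemma no_bad_family {T : H →L[ℂ] H} [CompleteSpace H] (hAN : IsAbsNormAttaining T)
    {ι : Type*} [Nonempty ι]
    (x : ι → H) (hx : Orthonormal ℂ x) (hTx : ∀ i j, i ≠ j → inner ℂ (T (x i)) (T (x j)) = 0)
    (c : ℝ) (hlt : ∀ i, ‖T (x i)‖ < c) (hsup : ∀ p < c, ∃ i, p < ‖T (x i)‖) : False := by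
  set M := (Submodule.span ℂ (Set.range x)).topologicalClosure with hM
  have hxM : ∀ i, x i ∈ M := fun i =>
    Submodule.le_topologicalClosure _ (Submodule.subset_span ⟨i, rfl⟩)
  have hne : M ≠ ⊥ := by
    intro h
    obtain ⟨i⟩ := ‹Nonempty ι›
    have := hxM i
    rw [h, Submodule.mem_bot] at this
    exact hx.ne_zero i this
  obtain ⟨y, hyM, hy1, hmax⟩ := an_exists_max hAN M (Submodule.isClosed_topologicalClosure _) hne
  have hc : c ≤ ‖T y‖ := by
    by_contra h
    push Not at h
    obtain ⟨i, hi⟩ := hsup _ h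
    have := hmax (x i) (hxM i)
    rw [hx.1 i] at this
    linarith
  -- vectors orthogonal to every `x i` are orthogonal to `M`
  have hdense : ∀ w : H, (∀ i, inner ℂ w (x i) = 0) → ∀ z ∈ M, inner ℂ w z = 0 := by
    intro w hw z hz
    have hcl : IsClosed (((ℂ ∙ w)ᗮ : Submodule ℂ H) : Set H) := Submodule.isClosed_orthogonal _
    have : M ≤ (ℂ ∙ w)ᗮ := by
      refine Submodule.topologicalClosure_minimal _ ?_ hcl
      rw [Submodule.span_le]
      rintro _ ⟨i, rfl⟩
      exact Submodule.mem_orthogonal_singleton_iff_inner_right.2 (hw i)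
    exact Submodule.mem_orthogonal_singleton_iff_inner_right.1 (this hz)
  have h0 : ∀ i, inner ℂ y (x i) = 0 := by
    intro i
    have h1 := max_variation hyM hy1 hmax (x i) (hxM i)
    have h2 : inner ℂ (T.adjoint (T (x i)) - ((‖T (x i)‖ ^ 2 : ℝ) : ℂ) • x i) y = 0 := by
      refine hdense _ ?_ y hyM
      intro j
      rw [inner_sub_left, ContinuousLinearMap.adjoint_inner_left, inner_smul_left]
      by_cases hij : i = j
      · subst hij
        rw [inner_self_eq_norm_sq_to_K, inner_self_eq_norm_sq_to_K, hx.1 i]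
        simp
      · rw [hTx i j hij, hx.2 hij]; simp
    rw [inner_sub_left, ContinuousLinearMap.adjoint_inner_left, inner_smul_left, sub_eq_zero,
      Complex.conj_ofReal] at h2
    have h3 := congrArg (starRingEnd ℂ) h2
    rw [map_mul, inner_conj_symm, inner_conj_symm, Complex.conj_ofReal, h1] at h3
    have h4 : (((‖T y‖ ^ 2 - ‖T (x i)‖ ^ 2 : ℝ)) : ℂ) * inner ℂ y (x i) = 0 := by
      push_cast at h3 ⊢
      rw [sub_mul, h3, sub_self]
    rcases mul_eq_zero.1 h4 with h5 | h5
    · exfalso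
      have h6 : ‖T y‖ ^ 2 - ‖T (x i)‖ ^ 2 = 0 := by exact_mod_cast h5
      have := hlt i
      nlinarith [norm_nonneg (T (x i))]
    · exact h5
  have := hdense y h0 y hyM
  rw [inner_self_eq_zero] at this
  simp [this] at hy1

lemma eigenspaces_total [CompleteSpace H] {T : H →L[ℂ] H} (hT : T.IsPositive)
    (hAN : IsAbsNormAttaining T) : (⨆ μ, Module.End.eigenspace (T : H →ₗ[ℂ] H) μ)ᗮ = ⊥ := by
  have hsym : (T : H →ₗ[ℂ] H).IsSymmetric := hT.isSymmetric
  by_contra hne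
  set M := (⨆ μ, Module.End.eigenspace (T : H →ₗ[ℂ] H) μ)ᗮ with hM
  have hinv : ∀ v ∈ M, T v ∈ M := fun v hv =>
    hsym.orthogonalComplement_iSup_eigenspaces_invariant hv
  obtain ⟨y, hyM, hy1, hmax⟩ := an_exists_max hAN M (Submodule.isClosed_orthogonal _) hne
  have hvar := max_variation hyM hy1 hmax
  set s := ‖T y‖ with hs
  have hy0 : y ≠ 0 := by rintro rfl; simp at hy1
  have hTT : T (T y) = ((s ^ 2 : ℝ) : ℂ) • y := by
    have hmem : T (T y) - ((s ^ 2 : ℝ) : ℂ) • y ∈ M :=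
      M.sub_mem (hinv _ (hinv _ hyM)) (M.smul_mem _ hyM)
    have h1 := hvar _ hmem
    rw [← sub_eq_zero, ← inner_self_eq_zero (𝕜 := ℂ)]
    nth_rewrite 1 [inner_sub_left]
    rw [inner_smul_left, Complex.conj_ofReal, ← h1, sub_eq_zero]
    exact hsym _ _
  have heig : ∃ μ : ℂ, T y = μ • y := by
    refine ⟨(s : ℂ), ?_⟩
    by_cases hs0 : s = 0
    · have : T y = 0 := norm_eq_zero.1 hs0
      simp [this, hs0]
    have hspos : 0 < s := lt_of_le_of_ne (norm_nonneg _) (Ne.symm hs0)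
    set w := T y - (s : ℂ) • y with hw
    have hTw : T w = -(s : ℂ) • w := by
      rw [hw, map_sub, map_smul, hTT, smul_sub, smul_smul]
      push_cast
      rw [neg_smul, neg_mul, neg_smul, sq]
      abel
    have hpos := hT.re_inner_nonneg_left w
    rw [hTw, inner_smul_left, inner_self_eq_norm_sq_to_K] at hpos
    have h7 : 0 ≤ -(s * ‖w‖ ^ 2) := by
      have h8 : ((starRingEnd ℂ) (-(s : ℂ)) * ((‖w‖ : ℝ) : ℂ) ^ 2)
          = ((-(s * ‖w‖ ^ 2) : ℝ) : ℂ) := by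
        simp
      change 0 ≤ (((starRingEnd ℂ) (-(s : ℂ)) * ((‖w‖ : ℝ) : ℂ) ^ 2)).re at hpos
      rw [h8, Complex.ofReal_re] at hpos
      exact hpos
    have h9 : ‖w‖ = 0 := by
      by_contra h
      have : 0 < ‖w‖ := lt_of_le_of_ne (norm_nonneg _) (Ne.symm h)
      have : 0 < s * ‖w‖ ^ 2 := by positivity
      linarith
    exact sub_eq_zero.1 (norm_eq_zero.1 h9)
  obtain ⟨μ, hμ⟩ := heig
  have hyE : y ∈ ⨆ μ, Module.End.eigenspace (T : H →ₗ[ℂ] H) μ :=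
    Submodule.mem_iSup_of_mem μ (Module.End.mem_eigenspace_iff.2 hμ)
  have := hyM y hyE
  rw [inner_self_eq_zero] at this
  exact hy0 this

universe u

set_option maxHeartbeats 1000000 in
lemma exists_eigenbasis {H : Type u} [NormedAddCommGroup H] [InnerProductSpace ℂ H]
    [CompleteSpace H] {T : H →L[ℂ] H} (hT : T.IsPositive) (hAN : IsAbsNormAttaining T) :
    ∃ (ι : Type u) (b : HilbertBasis ι ℂ H) (t : ι → ℝ), (∀ i, 0 ≤ t i) ∧
      ∀ i, T (b i) = ((t i : ℝ) : ℂ) • b i := by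
  have hsym : (T : H →ₗ[ℂ] H).IsSymmetric := hT.isSymmetric
  have hbot := eigenspaces_total hT hAN
  have hcl : ∀ μ, IsClosed ((Module.End.eigenspace (T : H →ₗ[ℂ] H) μ : Submodule ℂ H) : Set H) := by
    intro μ
    have : ((Module.End.eigenspace (T : H →ₗ[ℂ] H) μ : Submodule ℂ H) : Set H)
        = {v | T v = μ • v} := by
      ext v
      exact Module.End.mem_eigenspace_iff
    rw [this]
    exact isClosed_eq T.continuous (continuous_const_smul μ)
  have hcomp : ∀ μ, CompleteSpace (Module.End.eigenspace (T : H →ₗ[ℂ] H) μ) := fun μ =>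
    (hcl μ).completeSpace_coe
  choose w b hb using fun μ => exists_hilbertBasis ℂ (Module.End.eigenspace (T : H →ₗ[ℂ] H) μ)
  have hon := hsym.orthogonalFamily_eigenspaces.orthonormal_sigma_orthonormal
    (fun μ => (b μ).orthonormal)
  have hspan : (Submodule.span ℂ (Set.range fun a : Σ μ, w μ =>
      (Module.End.eigenspace (T : H →ₗ[ℂ] H) a.1).subtypeₗᵢ (b a.1 a.2)))ᗮ = ⊥ := by
    rw [eq_bot_iff, ← hbot]
    intro v hv
    rw [Submodule.mem_orthogonal] at hv
    rw [← Submodule.iInf_orthogonal, Submodule.mem_iInf]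
    intro μ u hu
    -- the functional `u ↦ ⟪v, u⟫` vanishes on a dense subspace of the eigenspace
    have hz : (Submodule.orthogonalProjectionOnto (Module.End.eigenspace (T : H →ₗ[ℂ] H) μ)) v = 0 := by
      apply (b μ).repr.injective
      ext i
      rw [(b μ).repr_apply_apply, map_zero]
      have := hv _ (Submodule.subset_span ⟨⟨μ, i⟩, rfl⟩)
      simpa using this
    exact (Submodule.orthogonalProjectionOnto_eq_zero_iff.1 hz) u hu
  refine ⟨_, HilbertBasis.mkOfOrthogonalEqBot hon hspan, fun a => RCLike.re (inner ℂ (T (b a.1 a.2 : H)) (b a.1 a.2 : H)), fun a => hT.re_inner_nonneg_left _, ?_⟩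
  intro a
  rw [HilbertBasis.coe_mkOfOrthogonalEqBot]
  have h1 : T (b a.1 a.2 : H) = a.1 • (b a.1 a.2 : H) :=
    Module.End.mem_eigenspace_iff.1 (b a.1 a.2).2
  have hn : ‖(b a.1 a.2 : H)‖ = 1 := (b a.1).orthonormal.1 a.2
  have h2 : (starRingEnd ℂ) a.1 = a.1 := by
    apply hsym.conj_eigenvalue_eq_self
    refine Module.End.hasEigenvalue_of_hasEigenvector (x := (b a.1 a.2 : H)) ⟨(b a.1 a.2).2, ?_⟩
    intro h
    rw [h] at hn; simp at hn
  change T (b a.1 a.2 : H) = _ • (b a.1 a.2 : H)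
  beta_reduce
  rw [h1, inner_smul_left, inner_self_eq_norm_sq_to_K, hn, h2]
  congr 1
  simpa using (Complex.conj_eq_iff_re.1 h2).symm


lemma not_both_infinite [CompleteSpace H] {T : H →L[ℂ] H} (hAN : IsAbsNormAttaining T)
    {ι : Type*} (b : HilbertBasis ι ℂ H) (t : ι → ℝ) (ht : ∀ i, 0 ≤ t i)
    (hb : ∀ i, T (b i) = ((t i : ℝ) : ℂ) • b i) {p q : ℝ} (hpq : p < q)
    (hp : {i | t i ≤ p}.Infinite) (hq : {i | q ≤ t i}.Infinite) : False := by
  classical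
  have hp' := hp.to_subtype
  have hq' := hq.to_subtype
  let f := Infinite.natEmbedding {i | t i ≤ p}
  let g := Infinite.natEmbedding {i | q ≤ t i}
  have hf : ∀ n, t (f n) ≤ p := fun n => (f n).2
  have hg : ∀ n, q ≤ t (g n) := fun n => (g n).2
  have hp0 : 0 ≤ p := (ht _).trans (hf 0)
  have hfi : ∀ n m, (f n : ι) = f m ↔ n = m := fun n m => by
    rw [Subtype.coe_inj, f.injective.eq_iff]
  have hgi : ∀ n m, (g n : ι) = g m ↔ n = m := fun n m => by
    rw [Subtype.coe_inj, g.injective.eq_iff]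
  have hfg : ∀ n m, (f n : ι) ≠ g m := fun n m h => by
    have h1 := hf n
    have h2 := hg m
    rw [h] at h1
    linarith
  have hgf : ∀ n m, (g n : ι) ≠ f m := fun n m h => hfg m n h.symm
  let c : ℕ → ℝ := fun n => q - (q - p) / (n + 2)
  have hcq : ∀ n, c n < q := fun n => by
    have : 0 < (q - p) / ((n : ℝ) + 2) := div_pos (by linarith) (by positivity)
    simp only [c]; linarith
  have hcp : ∀ n, p < c n := fun n => by
    have : (q - p) / ((n : ℝ) + 2) < q - p := by
      apply div_lt_self (by linarith)
      have : (0 : ℝ) ≤ n := Nat.cast_nonneg n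
      linarith
    simp only [c]; linarith
  have hex : ∀ n, ∃ u v : ℝ, u ^ 2 + v ^ 2 = 1 ∧
      u ^ 2 * t (f n) ^ 2 + v ^ 2 * t (g n) ^ 2 = c n ^ 2 := by
    intro n
    have h1 : t (f n) ^ 2 < c n ^ 2 := by nlinarith [ht (f n), hf n, hcp n]
    have h2 : c n ^ 2 < t (g n) ^ 2 := by nlinarith [hg n, hcq n, hcp n]
    set X := t (f n) ^ 2
    set Y := t (g n) ^ 2
    have h3 : 0 < Y - X := by linarith
    refine ⟨√((Y - c n ^ 2) / (Y - X)), √((c n ^ 2 - X) / (Y - X)), ?_, ?_⟩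
    · rw [Real.sq_sqrt (div_nonneg (by linarith) h3.le),
        Real.sq_sqrt (div_nonneg (by linarith) h3.le)]
      field_simp
      ring
    · rw [Real.sq_sqrt (div_nonneg (by linarith) h3.le),
        Real.sq_sqrt (div_nonneg (by linarith) h3.le)]
      field_simp
      ring
  choose u v huv hc using hex
  have hon := orthonormal_iff_ite.1 b.orthonormal
  let x : ℕ → H := fun n => ((u n : ℝ) : ℂ) • b (f n) + ((v n : ℝ) : ℂ) • b (g n)
  have hTx : ∀ n, T (x n) = ((u n * t (f n) : ℝ) : ℂ) • b (f n)
      + ((v n * t (g n) : ℝ) : ℂ) • b (g n) := by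
    intro n
    simp only [x, map_add, map_smul, hb, smul_smul, Complex.ofReal_mul]
  have gen : ∀ (r s r' s' : ℝ) (n m : ℕ), inner ℂ ((r : ℂ) • b (f n) + (s : ℂ) • b (g n))
      ((r' : ℂ) • b (f m) + (s' : ℂ) • b (g m)) = if n = m then ((r * r' + s * s' : ℝ) : ℂ) else 0 := by
    intro r s r' s' n m
    simp only [inner_add_left, inner_add_right, inner_smul_left, inner_smul_right, hon, hfi, hgi,
      hfg, hgf, Complex.conj_ofReal, if_false]
    by_cases h : n = m
    · simp only [h, if_true]
      push_cast
      ring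
    · simp [h]
  have hx : Orthonormal ℂ x := by
    rw [orthonormal_iff_ite]
    intro n m
    simp only [x, gen]
    by_cases h : n = m
    · subst h
      have := huv n
      simp only [if_true]
      rw [← sq, ← sq, this, Complex.ofReal_one]
    · simp [h]
  have hnorm : ∀ n, ‖T (x n)‖ = c n := by
    intro n
    have h1 : ((‖T (x n)‖ : ℝ) : ℂ) ^ 2 = ((c n ^ 2 : ℝ) : ℂ) := by
      have := inner_self_eq_norm_sq_to_K (𝕜 := ℂ) (T (x n))
      refine this.symm.trans ?_
      rw [hTx, gen, if_pos rfl, ← hc n]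
      congr 1
      ring
    have h2 : ‖T (x n)‖ ^ 2 = c n ^ 2 := by exact_mod_cast h1
    exact (pow_left_inj₀ (norm_nonneg _) (hp0.trans (hcp n).le) two_ne_zero).1 h2
  refine no_bad_family hAN x hx ?_ q (fun n => by rw [hnorm]; exact hcq n) ?_
  · intro n m hnm
    rw [hTx, hTx, gen, if_neg hnm]
  · intro r hr
    obtain ⟨n, hn⟩ := exists_nat_gt ((q - p) / (q - r))
    refine ⟨n, ?_⟩
    rw [hnorm]
    have h1 : (q - p) / ((n : ℝ) + 2) < q - r := by
      rw [div_lt_iff₀ (by linarith)] at hn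
      rw [div_lt_iff₀ (by positivity)]
      nlinarith
    simp only [c]; linarith

lemma norm_le_of_coeff {ι : Type*} (b : HilbertBasis ι ℂ H) (x y : H) (ε : ℝ) (hε : 0 ≤ ε)
    (h : ∀ i, ‖inner ℂ (b i) y‖ ≤ ε * ‖inner ℂ (b i) x‖) : ‖y‖ ≤ ε * ‖x‖ := by
  have hs : ∀ z : H, HasSum (fun i => ‖inner ℂ (b i) z‖ ^ 2) (‖z‖ ^ 2) := by
    intro z
    have h1 := b.hasSum_inner_mul_inner z z
    have h2 := Complex.hasSum_re h1
    convert h2 using 1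
    · funext i
      rw [← inner_conj_symm z (b i), ← Complex.normSq_eq_conj_mul_self, Complex.normSq_eq_norm_sq,
        Complex.ofReal_re]
    · rw [inner_self_eq_norm_sq_to_K]
      norm_cast
  have h3 := hasSum_le (fun i => ?_) (hs y) ((hs x).mul_left (ε ^ 2))
  · rw [← mul_pow] at h3
    exact (pow_le_pow_iff_left₀ (norm_nonneg _) (by positivity) two_ne_zero).1 h3
  · rw [← mul_pow]
    exact pow_le_pow_left₀ (norm_nonneg _) (h i) 2

lemma compact_of_diag [CompleteSpace H] {K : H →L[ℂ] H} {ι : Type*} (b : HilbertBasis ι ℂ H)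
    (k : ι → ℝ) (hk : ∀ i x, inner ℂ (b i) (K x) = ((k i : ℝ) : ℂ) * inner ℂ (b i) x)
    (hfin : ∀ ε > 0, {i | ε ≤ |k i|}.Finite) : IsCompactOperator K := by
  classical
  have hcl := isClosed_setOfPred_isCompactOperator (σ₁₂ := RingHom.id ℂ) (M₁ := H) (M₂ := H)
  have : K ∈ closure {f : H →L[ℂ] H | IsCompactOperator f} := by
    rw [Metric.mem_closure_iff]
    intro ε hε
    set F := (hfin (ε / 2) (by positivity)).toFinset with hF
    let P : H →L[ℂ] H := ∑ i ∈ F, (innerSL ℂ (b i)).smulRight (b i)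
    have hP : ∀ x, P x = ∑ i ∈ F, (inner ℂ (b i) x : ℂ) • b i := by
      intro x
      simp [P]
    have hPc : IsCompactOperator P := by
      have : ∀ G : Finset ι, IsCompactOperator
          (∑ i ∈ G, (innerSL ℂ (b i)).smulRight (b i) : H →L[ℂ] H) := by
        intro G
        induction G using Finset.induction_on with
        | empty => simpa using isCompactOperator_zero
        | insert a s has ih =>
          rw [Finset.sum_insert has]
          refine IsCompactOperator.add ?_ ih
          have hc : IsCompactOperator (innerSL ℂ (b a) : H →L[ℂ] ℂ) :=
            isCompactOperator_of_locallyCompactSpace_dom _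
          exact hc.clm_comp ((ContinuousLinearMap.id ℂ ℂ).smulRight (b a))
      exact this F
    refine ⟨K * P, hPc.clm_comp K, ?_⟩
    rw [dist_eq_norm]
    refine lt_of_le_of_lt (ContinuousLinearMap.opNorm_le_bound _ (by positivity : 0 ≤ ε / 2) ?_)
      (by linarith)
    intro x
    refine norm_le_of_coeff b x _ _ (by positivity) ?_
    intro i
    have h1 : inner ℂ (b i) ((K - K * P) x) = ((k i : ℝ) : ℂ) * (inner ℂ (b i) x
        - if i ∈ F then inner ℂ (b i) x else 0) := by
      change inner ℂ (b i) (K x - K (P x)) = _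
      rw [inner_sub_right, hk, hk, ← mul_sub, hP, inner_sum]
      congr 2
      simp [inner_smul_right, orthonormal_iff_ite.1 b.orthonormal]
    rw [h1, norm_mul, Complex.norm_real]
    by_cases hi : i ∈ F
    · simp only [hi, if_true, sub_self, norm_zero, mul_zero]
      positivity
    · simp only [hi, if_false, sub_zero]
      have : |k i| < ε / 2 := by
        simpa [hF] using hi
      exact mul_le_mul_of_nonneg_right this.le (norm_nonneg _)
  exact hcl.closure_subset this

end helpers


/-- If a positive operator on an infinite-dimensional complex Hilbert space is absolutely norm
attaining, then its essential spectrum is a singleton `{α}` with `α ≥ 0` and the spectrum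
contains only finitely many elements strictly less than `α`. -/
theorem positive_isAbsNormAttaining_essSpectrum
    {H : Type*} [NormedAddCommGroup H] [InnerProductSpace ℂ H] [CompleteSpace H]
    (h_inf : ¬ FiniteDimensional ℂ H) (T : H →L[ℂ] H) (hT : T.IsPositive)
    (hAN : IsAbsNormAttaining T) :
    ∃ α : ℝ, 0 ≤ α ∧ essSpectrum T = {(α : ℂ)} ∧
      {lam : ℝ | (lam : ℂ) ∈ spectrum ℂ T ∧ lam < α}.Finite := by
  obtain ⟨ι, b, t, ht, hb⟩ := exists_eigenbasis hT hAN
  have hsym : (T : H →ₗ[ℂ] H).IsSymmetric := hT.isSymmetric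
  have hcoef : ∀ i x, inner ℂ (b i) (T x) = ((t i : ℝ) : ℂ) * inner ℂ (b i) x := by
    intro i x
    have h1 : inner ℂ (T (b i)) x = inner ℂ (b i) (T x) := hsym _ _
    rw [← h1, hb, inner_smul_left, Complex.conj_ofReal]
  have hnormT : ∀ i, ‖T (b i)‖ = t i := by
    intro i
    rw [hb, norm_smul, b.orthonormal.1 i, Complex.norm_real, Real.norm_of_nonneg (ht i), mul_one]
  have hι : Infinite ι := by
    by_contra h
    rw [not_infinite_iff_finite] at h
    have := Fintype.ofFinite ι
    exact h_inf (b.toOrthonormalBasis.toBasis.finiteDimensional_of_finite)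
  -- the cut
  set A : Set ℝ := {p | {i | t i ≤ p}.Infinite} with hA
  have hAne : A.Nonempty := by
    refine ⟨‖T‖, ?_⟩
    have : {i | t i ≤ ‖T‖} = Set.univ := by
      ext i
      simp only [Set.mem_ofPred_eq, Set.mem_univ, iff_true]
      rw [← hnormT i]
      simpa [b.orthonormal.1 i] using T.le_opNorm (b i)
    change {i | t i ≤ ‖T‖}.Infinite
    rw [this]
    exact Set.infinite_univ
  have hA0 : ∀ p ∈ A, 0 ≤ p := by
    intro p hp
    obtain ⟨i, hi⟩ := Set.Infinite.nonempty hp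
    exact (ht i).trans hi
  have hAb : BddBelow A := ⟨0, hA0⟩
  set α := sInf A with hα
  have hlow : ∀ p < α, {i | t i ≤ p}.Finite := by
    intro p hp
    by_contra h
    exact absurd (csInf_le hAb (show p ∈ A from h)) (not_le.2 hp)
  have hhigh : ∀ q > α, {i | q ≤ t i}.Finite := by
    intro q hq
    obtain ⟨p, hpA, hpq⟩ := exists_lt_of_csInf_lt hAne hq
    by_contra h
    exact not_both_infinite hAN b t ht hb hpq hpA h
  have hK : IsCompactOperator (T - (α : ℂ) • 1 : H →L[ℂ] H) := by
    refine compact_of_diag b (fun i => t i - α) ?_ ?_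
    · intro i x
      change inner ℂ (b i) (T x - (α : ℂ) • x) = _
      rw [inner_sub_right, hcoef, inner_smul_right]
      push_cast
      ring
    · intro ε hε
      refine ((hlow (α - ε) (by linarith)).union (hhigh (α + ε) (by linarith))).subset ?_
      intro i hi
      rcases le_abs.1 (show ε ≤ |t i - α| from hi) with h | h
      · right
        change α + ε ≤ t i
        linarith
      · left
        change t i ≤ α - ε
        linarith
  refine ⟨α, le_csInf hAne hA0, ?_, ?_⟩
  · ext lam
    rw [Set.mem_singleton_iff]
    constructor
    · intro hlam
      by_contra hne
      apply hlam
      have hne' : (α : ℂ) - lam ≠ 0 := sub_ne_zero.2 (Ne.symm hne)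
      have hKs : IsCompactOperator
          (((α : ℂ) - lam)⁻¹ • (T - (α : ℂ) • 1) : H →L[ℂ] H) := hK.smul _
      have e : ((α : ℂ) - lam)⁻¹ • (T - lam • 1) - 1
          = (((α : ℂ) - lam)⁻¹ • (T - (α : ℂ) • 1) : H →L[ℂ] H) := by
        have : T - lam • (1 : H →L[ℂ] H) = (T - (α : ℂ) • 1) + ((α : ℂ) - lam) • 1 := by
          rw [sub_smul]; abel
        rw [this, smul_add, smul_smul, inv_mul_cancel₀ hne', one_smul, add_sub_cancel_right]
      refine ⟨((α : ℂ) - lam)⁻¹ • 1, ?_, ?_⟩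
      · rw [smul_mul_assoc, one_mul, e]
        exact hKs
      · rw [mul_smul_comm, mul_one, e]
        exact hKs
    · rintro rfl ⟨S, hS, -⟩
      have h1 : IsCompactOperator (S * (T - (α : ℂ) • 1) : H →L[ℂ] H) := hK.clm_comp S
      have h2 := h1.sub hS
      apply h_inf
      apply FiniteDimensional.of_isCompactOperator_id (𝕜 := ℂ)
      have h3 : (⇑(S * (T - (α : ℂ) • 1) : H →L[ℂ] H) - ⇑(S * (T - (α : ℂ) • 1) - 1 : H →L[ℂ] H))
          = (id : H → H) := by
        funext x
        simp
      rw [h3] at h2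
      exact h2
  · have hfin : {i | t i < α}.Finite := by
      by_contra hinf
      have hinf' : {i | t i < α}.Infinite := hinf
      have hne := hinf'.nonempty.to_subtype
      refine no_bad_family hAN (fun i : {i | t i < α} => b i)
        (b.orthonormal.comp _ Subtype.val_injective) ?_ α ?_ ?_
      · intro i j hij
        rw [hb, hb, inner_smul_left, inner_smul_right,
          b.orthonormal.2 (fun h => hij (Subtype.ext h))]
        simp
      · intro i
        rw [hnormT]
        exact i.2
      · intro p hp
        by_contra hcon
        push Not at hcon
        refine hinf' ((hlow p hp).subset ?_)
        intro i hi
        have := hcon ⟨i, hi⟩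
        rw [hnormT] at this
        exact this
    refine (hfin.image t).subset ?_
    rintro lam ⟨hspec, hlt⟩
    have hne : ((lam : ℂ) - α) ≠ 0 := by
      rw [← Complex.ofReal_sub]
      exact_mod_cast (sub_neg.2 hlt).ne
    have hmem : ((lam : ℂ) - α) ∈ spectrum ℂ (T - (α : ℂ) • 1 : H →L[ℂ] H) := by
      rw [spectrum.mem_iff] at hspec ⊢
      convert hspec using 2
      simp only [Algebra.algebraMap_eq_smul_one, sub_smul]
      abel
    obtain ⟨v, hv, hv0⟩ :=
      ((hK.hasEigenvalue_iff_mem_spectrum hne).2 hmem).exists_hasEigenvector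
    have hv1 : T v - (α : ℂ) • v = ((lam : ℂ) - α) • v := Module.End.mem_eigenspace_iff.1 hv
    have hTv : T v = (lam : ℂ) • v := by
      rw [sub_smul] at hv1
      exact sub_left_injective hv1
    have : ∃ i, inner ℂ (b i) v ≠ 0 := by
      by_contra hcon
      push Not at hcon
      apply hv0
      apply b.repr.injective
      ext i
      rw [b.repr_apply_apply, hcon, map_zero]
      rfl
    obtain ⟨i, hi⟩ := this
    have h1 := hcoef i v
    rw [hTv, inner_smul_right] at h1
    have h2 : lam = t i := by exact_mod_cast mul_right_cancel₀ hi h1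
    exact ⟨i, by rw [Set.mem_ofPred_eq, ← h2]; exact hlt, h2.symm⟩
end

section
/- Let H be an infinite-dimensional complex Hilbert space and let T be a positive bounded linear operator on H. If there exists α ≥ 0 such that the essential spectrum of T equals the singleton {α} and the spectrum σ(T) contains only finitely many elements strictly less than α, then T is absolutely norm attaining. -/
open Filter Topology in
/-- If a closed subspace carries a supremum exceeding the essential value, it is attained. -/
theorem attain_of_gt {H : Type*} [NormedAddCommGroup H] [InnerProductSpace ℂ H] [CompleteSpace H]
    (T : H →L[ℂ] H) (hT : IsSelfAdjoint T) (α s : ℝ) (hα : 0 ≤ α) (hs : α < s)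
    (A : H →L[ℂ] H) (hA : IsCompactOperator A)
    (hTA : ∀ x, T (T x) = A x + ((α ^ 2 : ℝ) : ℂ) • x)
    (M : Submodule ℂ H) (hM : IsClosed (M : Set H))
    (hle : ∀ x ∈ M, ‖T x‖ ≤ s * ‖x‖)
    (x : ℕ → H) (hxM : ∀ n, x n ∈ M) (hx1 : ∀ n, ‖x n‖ ≤ 1)
    (hx : Tendsto (fun n => ‖T (x n)‖) atTop (𝓝 s)) :
    ∃ x₀ ∈ M, ‖x₀‖ ≤ 1 ∧ ‖T x₀‖ = s := by
  have : CompleteSpace M := hM.completeSpace_coe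
  have hs0 : 0 < s := lt_of_le_of_lt hα hs
  have hd : 0 < s ^ 2 - α ^ 2 := by nlinarith
  have hsym : ∀ u v, inner ℂ (T u) v = inner ℂ u (T v) := fun u v => by
    have := ContinuousLinearMap.adjoint_inner_left T v u
    rwa [← ContinuousLinearMap.star_eq_adjoint, hT.star_eq] at this
  set P : H →L[ℂ] H := M.starProjection with hP
  have hPin : ∀ u, ∀ v ∈ M, inner ℂ (P u) v = inner ℂ u v := fun u v hv => by
    rw [hP, Submodule.inner_starProjection_left_eq_right,
      Submodule.starProjection_eq_self_iff.2 hv]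
  have hPM : ∀ u, P u ∈ M := fun u => Submodule.starProjection_apply_mem M u
  have key : ∀ u ∈ M, ‖u‖ ≤ 1 →
      ‖P (T (T u)) - ((s ^ 2 : ℝ) : ℂ) • u‖ ^ 2 ≤ 2 * s ^ 2 * (s ^ 2 - ‖T u‖ ^ 2) := by
    intro u hu hu1
    set w := P (T (T u)) with hw
    have hwM : w ∈ M := hPM _
    have h1 : ‖w‖ ^ 2 ≤ s ^ 2 * ‖w‖ := by
      have e : inner ℂ w w = inner ℂ (T u) (T w) := by
        conv_lhs => rw [hw]
        rw [hPin _ _ hwM, hsym]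
      have e2 : ‖w‖ ^ 2 = ‖inner ℂ w w‖ := by
        rw [inner_self_eq_norm_sq_to_K]; simp
      rw [e2, e]
      calc _ ≤ ‖T u‖ * ‖T w‖ := norm_inner_le_norm _ _
        _ ≤ (s * 1) * (s * ‖w‖) := by
          gcongr
          · exact (hle u hu).trans (by gcongr)
          · exact hle w hwM
        _ = _ := by ring
    have h2 : ‖w‖ ≤ s ^ 2 := by
      by_contra! hc
      nlinarith [sq_nonneg s]
    have h3 : RCLike.re (inner ℂ w (((s ^ 2 : ℝ) : ℂ) • u)) = s ^ 2 * ‖T u‖ ^ 2 := by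
      rw [inner_smul_right, hPin _ _ hu, hsym, RCLike.re_to_complex, Complex.re_ofReal_mul,
        ← RCLike.re_to_complex, inner_self_eq_norm_sq]
    rw [@norm_sub_sq ℂ, h3, norm_smul]
    have h4 : ‖((s ^ 2 : ℝ) : ℂ)‖ = s ^ 2 := by
      rw [Complex.norm_real, Real.norm_of_nonneg (by positivity)]
    rw [h4]
    have h5 : ‖w‖ ^ 2 ≤ (s ^ 2) ^ 2 := by gcongr
    have h6 : (s ^ 2 * ‖u‖) ^ 2 ≤ (s ^ 2 * 1) ^ 2 := by gcongr
    nlinarith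
  obtain ⟨K, hK, hKsub⟩ := hA.image_closedBall_subset_compact (f := (A : H →ₗ[ℂ] H)) 1
  obtain ⟨z, -, φ, hφ, hz⟩ := hK.tendsto_subseq (x := fun n => A (x n))
    (fun n => hKsub ⟨x n, by simpa using hx1 n, rfl⟩)
  have hxφ := hx.comp hφ.tendsto_atTop
  have hdiff : Tendsto (fun n => P (T (T (x (φ n)))) - ((s ^ 2 : ℝ) : ℂ) • x (φ n)) atTop (𝓝 0) := by
    rw [tendsto_zero_iff_norm_tendsto_zero]
    have hsq : Tendsto (fun n => ‖P (T (T (x (φ n)))) - ((s ^ 2 : ℝ) : ℂ) • x (φ n)‖ ^ 2)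
        atTop (𝓝 0) := by
      refine squeeze_zero (fun n => by positivity) (fun n => key _ (hxM _) (hx1 _)) ?_
      have := ((tendsto_const_nhds (x := s ^ 2)).sub (hxφ.pow 2)).const_mul (2 * s ^ 2)
      simpa using this
    have := hsq.sqrt
    simpa using this
  have hconv : Tendsto (fun n => x (φ n)) atTop
      (𝓝 ((((s ^ 2 - α ^ 2)⁻¹ : ℝ) : ℂ) • (P z - 0))) := by
    have h1 := (((P.continuous.tendsto z).comp hz).sub hdiff).const_smul
      (((s ^ 2 - α ^ 2)⁻¹ : ℝ) : ℂ)
    refine h1.congr fun n => ?_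
    have hPx : P (x (φ n)) = x (φ n) := Submodule.starProjection_eq_self_iff.2 (hxM _)
    simp only [Function.comp]
    rw [hTA, map_add, map_smul, hPx]
    have : P (A (x (φ n))) - (P (A (x (φ n))) + ((α ^ 2 : ℝ) : ℂ) • x (φ n)
        - ((s ^ 2 : ℝ) : ℂ) • x (φ n)) = ((s ^ 2 - α ^ 2 : ℝ) : ℂ) • x (φ n) := by
      push_cast
      module
    rw [this, smul_smul, ← Complex.ofReal_mul, inv_mul_cancel₀ hd.ne']
    simp
  refine ⟨_, hM.mem_of_tendsto hconv (Eventually.of_forall fun n => hxM _), 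
    le_of_tendsto hconv.norm (Eventually.of_forall fun n => hx1 _), ?_⟩
  exact tendsto_nhds_unique (((T.continuous.tendsto _).comp hconv).norm) hxφ

/-- Every continuous function vanishing at the essential value gives a compact operator. -/
theorem compact_cfcHom {H : Type*} [NormedAddCommGroup H] [InnerProductSpace ℂ H] [CompleteSpace H]
    (T : H →L[ℂ] H) (hT : IsSelfAdjoint T) (α : ℝ) (hess : essSpectrum T = {(α : ℂ)})
    (f : C(spectrum ℝ T, ℝ)) (hf : ∀ x, x.1 = α → f x = 0) :
    IsCompactOperator (cfcHom (R := ℝ) hT f) := by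
  set Φ := cfcHom (R := ℝ) hT with hΦ
  have hΦid : Φ (.restrict (spectrum ℝ T) <| .id ℝ) = T := cfcHom_id hT
  have hΦc : Continuous Φ := (isometry_cfcHom T hT).continuous
  let J : Ideal C(spectrum ℝ T, ℝ) :=
    { carrier := {g | IsCompactOperator (Φ g)}
      add_mem' := by
        intro a b ha hb
        change IsCompactOperator (Φ (a + b))
        rw [map_add]
        exact IsCompactOperator.add ha hb
      zero_mem' := by
        change IsCompactOperator (Φ 0)
        rw [map_zero]
        exact isCompactOperator_zero
      smul_mem' := by
        intro c a ha
        change IsCompactOperator (Φ (c * a))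
        rw [map_mul]
        exact IsCompactOperator.clm_comp ha (Φ c) }
  have hJ : ∀ g, g ∈ J ↔ IsCompactOperator (Φ g) := fun g => Iff.rfl
  have hJc : IsClosed (J : Set C(spectrum ℝ T, ℝ)) :=
    IsClosed.preimage hΦc (isClosed_setOfPred_isCompactOperator (σ₁₂ := RingHom.id ℂ))
  rw [← hJ, ← ContinuousMap.idealOfSet_ofIdeal_isClosed hJc, ContinuousMap.mem_idealOfSet]
  intro l hl
  by_contra hfl
  have hla : l.1 ≠ α := fun h => hfl (hf l h)
  apply hl
  rw [ContinuousMap.mem_setOfIdeal]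
  have hne : ((l.1 : ℝ) : ℂ) ∉ essSpectrum T := by
    rw [hess]; simpa using hla
  obtain ⟨S, hS, -⟩ := not_not.1 hne
  set δ : ℝ := (‖S‖ + 1)⁻¹ with hδ
  have hδ0 : 0 < δ := by positivity
  let g : C(spectrum ℝ T, ℝ) := ⟨fun x => max (δ - |x.1 - l.1|) 0, by fun_prop⟩
  let d : C(spectrum ℝ T, ℝ) := ⟨fun x => max (-δ) (min δ (x.1 - l.1)), by fun_prop⟩
  refine ⟨g, ?_, by simp [g, hδ0.ne', hδ0.le]⟩
  rw [hJ]
  have hd : ‖Φ d‖ ≤ δ := by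
    rw [hΦ, norm_cfcHom T d hT, ContinuousMap.norm_le _ hδ0.le]
    intro x
    rw [Real.norm_eq_abs, abs_le]
    exact ⟨le_max_left _ _, max_le (by linarith) (min_le_left _ _)⟩
  have hdg : (.restrict (spectrum ℝ T) (.id ℝ) - algebraMap ℝ C(spectrum ℝ T, ℝ) l.1) * g
      = d * g := by
    ext x
    change (x.1 - l.1) * max (δ - |x.1 - l.1|) 0
      = max (-δ) (min δ (x.1 - l.1)) * max (δ - |x.1 - l.1|) 0
    rcases le_total |x.1 - l.1| δ with h | h
    · rw [abs_le] at h
      rw [min_eq_right h.2, max_eq_right h.1]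
    · rw [max_eq_right (by linarith)]; simp
  have hTg : (T - ((l.1 : ℝ) : ℂ) • 1) * Φ g = Φ d * Φ g := by
    rw [← map_mul, ← hdg, map_mul, map_sub, hΦid, AlgHomClass.commutes]
    congr 2
  have hlt : ‖S * Φ d‖ < 1 := by
    calc _ ≤ ‖S‖ * ‖Φ d‖ := norm_mul_le _ _
      _ ≤ ‖S‖ * δ := by gcongr
      _ < 1 := by
        rw [hδ, ← div_eq_mul_inv, div_lt_one (by positivity)]; linarith
  obtain ⟨u, hu⟩ := isUnit_one_sub_of_norm_lt_one hlt
  have e : Φ g = (-(u⁻¹ : (H →L[ℂ] H)ˣ) : H →L[ℂ] H) *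
      ((S * (T - ((l.1 : ℝ) : ℂ) • 1) - 1) * Φ g) := by
    have : (S * (T - ((l.1 : ℝ) : ℂ) • 1) - 1) * Φ g = -(u * Φ g) := by
      rw [sub_mul, mul_assoc, hTg, hu, sub_mul, mul_assoc]; abel
    rw [this, neg_mul_neg, Units.inv_mul_cancel_left]
  rw [e]
  exact (hS.comp_clm (Φ g)).clm_comp (-(u⁻¹ : (H →L[ℂ] H)ˣ) : H →L[ℂ] H)

/-- If the essential spectrum of a positive operator `T` on an infinite-dimensional complex
Hilbert space is a singleton `{α}` with `α ≥ 0` and the spectrum contains only finitely many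
elements strictly less than `α`, then `T` is absolutely norm attaining. -/
theorem isAbsNormAttaining_of_essSpectrum_singleton
    {H : Type*} [NormedAddCommGroup H] [InnerProductSpace ℂ H] [CompleteSpace H]
    (h_inf : ¬ FiniteDimensional ℂ H) (T : H →L[ℂ] H) (hT : T.IsPositive)
    (α : ℝ) (hα : 0 ≤ α) (hess : essSpectrum T = {(α : ℂ)})
    (hfin : {lam : ℝ | (lam : ℂ) ∈ spectrum ℂ T ∧ lam < α}.Finite) :
    IsAbsNormAttaining T := by
  intro M hM hM0
  have hsa : IsSelfAdjoint T := hT.isSelfAdjoint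
  have hcomp := compact_cfcHom T hsa α hess
  set Φ := cfcHom (R := ℝ) hsa with hΦ
  have hΦid : Φ (.restrict (spectrum ℝ T) <| .id ℝ) = T := cfcHom_id hsa
  set S : Set ℝ := (fun x => ‖T x‖) '' {x : H | x ∈ M ∧ ‖x‖ ≤ 1} with hS
  have hSne : S.Nonempty := ⟨_, 0, ⟨M.zero_mem, by simp⟩, rfl⟩
  have hSb : BddAbove S := by
    refine ⟨‖T‖, ?_⟩
    rintro _ ⟨x, hx, rfl⟩
    exact T.unit_le_opNorm x hx.2
  have hub : ∀ x ∈ M, ‖x‖ ≤ 1 → ‖T x‖ ≤ sSup S := fun x hx h1 =>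
    le_csSup hSb ⟨x, ⟨hx, h1⟩, rfl⟩
  have hle : ∀ x ∈ M, ‖T x‖ ≤ sSup S * ‖x‖ := by
    intro x hx
    rcases eq_or_ne x 0 with rfl | h0
    · simp
    have hn : 0 < ‖x‖ := norm_pos_iff.2 h0
    have := hub (((‖x‖⁻¹ : ℝ) : ℂ) • x) (M.smul_mem _ hx) (by
      rw [norm_smul, Complex.norm_real, norm_inv, norm_norm, inv_mul_cancel₀ hn.ne'])
    rw [map_smul, norm_smul, Complex.norm_real, norm_inv, norm_norm, inv_mul_le_iff₀ hn] at this
    linarith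
  let a : C(spectrum ℝ T, ℝ) := ⟨fun x => x.1 ^ 2 - α ^ 2, by fun_prop⟩
  have ha : Φ a = T * T - ((α ^ 2 : ℝ) : ℂ) • 1 := by
    have : a = (.restrict (spectrum ℝ T) (.id ℝ)) * (.restrict (spectrum ℝ T) (.id ℝ))
        - algebraMap ℝ C(spectrum ℝ T, ℝ) (α ^ 2) := by
      ext x
      change x.1 ^ 2 - α ^ 2 = x.1 * x.1 - α ^ 2
      ring
    rw [this, map_sub, map_mul, hΦid, AlgHomClass.commutes]
    congr 1
  have hTA : ∀ x, T (T x) = Φ a x + ((α ^ 2 : ℝ) : ℂ) • x := by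
    intro x
    rw [ha]; simp
  rcases lt_or_ge α (sSup S) with hs | hs
  · obtain ⟨y, -, hy, hyS⟩ := exists_seq_tendsto_sSup hSne hSb
    choose x hx hxy using hyS
    have hxy' : (fun n => ‖T (x n)‖) = y := funext hxy
    exact attain_of_gt T hsa α _ hα hs (Φ a)
      (hcomp a (fun x hx => by change x.1 ^ 2 - α ^ 2 = 0; rw [hx]; ring)) hTA M hM hle x
      (fun n => (hx n).1) (fun n => (hx n).2) (hxy' ▸ hy)
  · let U : Set (spectrum ℝ T) := {x | x.1 < α}
    have hUo : IsOpen U := isOpen_lt (by fun_prop) (by fun_prop)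
    have hUf : U.Finite := by
      refine Set.Finite.of_finite_image (f := Subtype.val) (hfin.subset ?_)
        Subtype.val_injective.injOn
      rintro _ ⟨x, hx, rfl⟩
      exact ⟨(spectrum.algebraMap_mem_iff ℂ).2 x.2, hx⟩
    have hUc : IsClopen U := ⟨hUf.isClosed, hUo⟩
    let p : C(spectrum ℝ T, ℝ) := ⟨U.indicator (fun _ => 1), hUc.continuous_indicator (by fun_prop)⟩
    have hp : IsCompactOperator (Φ p) := hcomp p (fun x hx => by
      change U.indicator (fun _ => 1) x = 0
      refine Set.indicator_of_notMem ?_ _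
      change ¬ x.1 < α
      rw [hx]; exact lt_irrefl _)
    have hpp : Φ p * Φ p = Φ p := by
      rw [← map_mul]
      congr 1
      ext x
      change U.indicator (fun _ => (1 : ℝ)) x * U.indicator (fun _ => 1) x
        = U.indicator (fun _ => 1) x
      by_cases h : x ∈ U <;> simp [h]
    have hfd : FiniteDimensional ℂ
        (Module.End.eigenspace ((Φ p : H →L[ℂ] H) : H →ₗ[ℂ] H) (1 : ℂ)) :=
      ContinuousLinearMap.finite_dimensional_eigenspace hp 1 one_ne_zero
    have hpos : 0 ≤ Φ (a * (1 - p)) := by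
      rw [hΦ, cfcHom_nonneg_iff hsa, ContinuousMap.le_def]
      intro x
      change 0 ≤ (x.1 ^ 2 - α ^ 2) * (1 - U.indicator (fun _ => 1) x)
      by_cases h : x ∈ U
      · simp [h]
      · have h' : α ≤ x.1 := not_lt.1 h
        simp only [h, not_false_eq_true, Set.indicator_of_notMem, sub_zero, mul_one]
        nlinarith
    by_cases hker : ∃ v ∈ M, v ≠ 0 ∧ Φ p v = 0
    · obtain ⟨v, hv, hv0, hpv⟩ := hker
      have hge : α * ‖v‖ ≤ ‖T v‖ := by
        have h1 : Φ (a * (1 - p)) v = Φ a v := by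
          rw [map_mul, map_sub, map_one]
          simp [hpv]
        have h2 := ((ContinuousLinearMap.nonneg_iff_isPositive _).1 hpos).re_inner_nonneg_left v
        have h3 : Φ a v = T (T v) - ((α ^ 2 : ℝ) : ℂ) • v := by rw [hTA]; simp
        have h4 : inner ℂ (T (T v)) v = inner ℂ (T v) (T v) := by
          have := ContinuousLinearMap.adjoint_inner_left T v (T v)
          rwa [← ContinuousLinearMap.star_eq_adjoint, hsa.star_eq] at this
        rw [h1, h3, inner_sub_left, h4, inner_smul_left, map_sub, inner_self_eq_norm_sq,
          Complex.conj_ofReal, RCLike.re_to_complex, Complex.re_ofReal_mul,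
          ← RCLike.re_to_complex, inner_self_eq_norm_sq] at h2
        refine le_of_sq_le_sq ?_ (norm_nonneg _)
        rw [mul_pow]
        linarith
      have hn : 0 < ‖v‖ := norm_pos_iff.2 hv0
      have h1 : ‖((‖v‖⁻¹ : ℝ) : ℂ) • v‖ = 1 := by
        rw [norm_smul, Complex.norm_real, norm_inv, norm_norm, inv_mul_cancel₀ hn.ne']
      refine ⟨((‖v‖⁻¹ : ℝ) : ℂ) • v, M.smul_mem _ hv, h1.le,
        le_antisymm (hub _ (M.smul_mem _ hv) h1.le) (hs.trans ?_)⟩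
      rw [map_smul, norm_smul, Complex.norm_real, norm_inv, norm_norm, le_inv_mul_iff₀ hn]
      linarith
    · push Not at hker
      let L : M →ₗ[ℂ] Module.End.eigenspace ((Φ p : H →L[ℂ] H) : H →ₗ[ℂ] H) (1 : ℂ) :=
        LinearMap.codRestrict _ (((Φ p : H →L[ℂ] H) : H →ₗ[ℂ] H).comp M.subtype) (fun x => by
          rw [Module.End.mem_eigenspace_iff, one_smul]
          exact congrArg (fun F : H →L[ℂ] H => F x) hpp)
      have hL : Function.Injective L := by
        rw [injective_iff_map_eq_zero]
        intro x hx
        by_contra h0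
        exact hker x x.2 (by simpa using h0) (congrArg Subtype.val hx)
      have : FiniteDimensional ℂ M := FiniteDimensional.of_injective L hL
      have : ProperSpace M := FiniteDimensional.proper ℂ M
      obtain ⟨x, hx, hmax⟩ := (isCompact_closedBall (0 : M) 1).exists_isMaxOn
        ⟨0, by simp⟩ (f := fun x : M => ‖T x‖) (by fun_prop)
      have hx1 : ‖(x : H)‖ ≤ 1 := by simpa using hx
      refine ⟨x, x.2, hx1, le_antisymm (hub _ x.2 hx1) (csSup_le hSne ?_)⟩
      rintro _ ⟨y, ⟨hy, hy1⟩, rfl⟩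
      exact hmax (show (⟨y, hy⟩ : M) ∈ Metric.closedBall (0 : M) 1 by simpa using hy1)
end

section
/- Let H be a complex Hilbert space and let T be a positive bounded linear operator on H. Then T is absolutely norm attaining if and only if T = αI + K + F where α ≥ 0 is a scalar, K is a positive compact operator on H, and F is a self-adjoint finite-rank operator on H. -/
open Filter Topology

section AuxAN

variable {H : Type*} [NormedAddCommGroup H] [InnerProductSpace ℂ H] [CompleteSpace H]

theorem aux_pos_bound (Q : H →L[ℂ] H) (hQ : Q.IsPositive) :
    ∃ C : ℝ, 0 ≤ C ∧ ∀ x, ‖Q x‖ ^ 2 ≤ C * (inner ℂ (Q x) x).re := by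
  have h0 : 0 ≤ Q := (ContinuousLinearMap.nonneg_iff_isPositive Q).2 hQ
  set R := CFC.sqrt Q with hR
  have hRR : R * R = Q := CFC.sqrt_mul_sqrt_self Q h0
  have hRp : R.IsPositive := (ContinuousLinearMap.nonneg_iff_isPositive R).1 (CFC.sqrt_nonneg Q)
  have hap : ∀ x, Q x = R (R x) := fun x => by rw [← hRR]; rfl
  refine ⟨‖R‖ ^ 2, by positivity, fun x => ?_⟩
  have h1 : (inner ℂ (Q x) x).re = ‖R x‖ ^ 2 := by
    rw [hap, hRp.inner_left_eq_inner_right]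
    exact inner_self_eq_norm_sq (𝕜 := ℂ) (R x)
  rw [h1, hap, ← mul_pow]
  gcongr
  exact R.le_opNorm _

theorem aux_crit (T : H →L[ℂ] H) (hT : IsSelfAdjoint T) (M : Submodule ℂ H)
    [M.HasOrthogonalProjection] (s : ℝ) (hs : ∀ x ∈ M, ‖T x‖ ≤ s * ‖x‖) :
    ∃ C : ℝ, 0 ≤ C ∧ ∀ x ∈ M, ‖M.starProjection (((s ^ 2 : ℝ) : ℂ) • x - T (T x))‖ ^ 2
      ≤ C * (s ^ 2 * ‖x‖ ^ 2 - ‖T x‖ ^ 2) := by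
  have hsym : ∀ x y, inner ℂ (T x) y = inner ℂ x (T y) := fun x y => hT.isSymmetric x y
  set A : H →L[ℂ] H := ((s ^ 2 : ℝ) : ℂ) • 1 - T * T with hA
  have hAx : ∀ x, A x = ((s ^ 2 : ℝ) : ℂ) • x - T (T x) := fun x => rfl
  have hAsa : IsSelfAdjoint A := by
    refine IsSelfAdjoint.sub ?_ ?_
    · refine IsSelfAdjoint.smul ?_ (IsSelfAdjoint.one _)
      exact Complex.conj_ofReal _
    · exact hT.commute_iff hT |>.1 rfl
  have hAin : ∀ x, (inner ℂ (A x) x).re = s ^ 2 * ‖x‖ ^ 2 - ‖T x‖ ^ 2 := by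
    intro x
    rw [hAx, inner_sub_left, hsym (T x) x, inner_smul_left, inner_self_eq_norm_sq_to_K,
      inner_self_eq_norm_sq_to_K, Complex.conj_ofReal]
    change (((s ^ 2 : ℝ) : ℂ) * ((‖x‖ : ℝ) : ℂ) ^ 2 - ((‖T x‖ : ℝ) : ℂ) ^ 2).re = _
    rw [← Complex.ofReal_pow, ← Complex.ofReal_pow, ← Complex.ofReal_mul, ← Complex.ofReal_sub,
      Complex.ofReal_re]
  set P := M.starProjection
  have hPin : ∀ x, inner ℂ ((P ∘L A ∘L P) x) x = inner ℂ (A (P x)) (P x) := fun x =>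
    M.inner_starProjection_left_eq_right (A (P x)) x
  have hQ : (P ∘L A ∘L P).IsPositive := by
    rw [ContinuousLinearMap.isPositive_def']
    refine ⟨hAsa.conj_starProjection M, fun x => ?_⟩
    rw [ContinuousLinearMap.reApplyInnerSelf_apply, hPin]
    change 0 ≤ (inner ℂ (A (P x)) (P x)).re
    rw [hAin, ← mul_pow, sub_nonneg]
    gcongr
    exact hs _ (M.starProjection_apply_mem x)
  obtain ⟨C, hC, h⟩ := aux_pos_bound _ hQ
  refine ⟨C, hC, fun x hx => ?_⟩
  have hPx : P x = x := Submodule.starProjection_eq_self_iff.2 hx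
  have := h x
  rw [hPin, hPx, hAin] at this
  simpa [hPx, hAx] using this

/-- Basic properties of the supremum. -/
theorem aux_sup (T : H →L[ℂ] H) (M : Submodule ℂ H) (s : ℝ)
    (hs : s = sSup ((fun x => ‖T x‖) '' {x : H | x ∈ M ∧ ‖x‖ ≤ 1})) :
    IsLUB ((fun x => ‖T x‖) '' {x : H | x ∈ M ∧ ‖x‖ ≤ 1}) s ∧ 0 ≤ s ∧
      ∀ x ∈ M, ‖T x‖ ≤ s * ‖x‖ := by
  have hL : IsLUB ((fun x => ‖T x‖) '' {x : H | x ∈ M ∧ ‖x‖ ≤ 1}) s := by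
    rw [hs]
    refine isLUB_csSup ⟨_, 0, ⟨M.zero_mem, by simp⟩, rfl⟩ ⟨‖T‖, ?_⟩
    rintro _ ⟨x, ⟨-, hx⟩, rfl⟩
    exact (T.le_opNorm x).trans (mul_le_of_le_one_right (norm_nonneg _) hx)
  refine ⟨hL, ?_, fun x hx => ?_⟩
  · exact hL.1 ⟨0, ⟨M.zero_mem, by simp⟩, by simp⟩
  · by_cases h0 : x = 0
    · simp [h0]
    have hn : 0 < ‖x‖ := norm_pos_iff.2 h0
    have := hL.1 ⟨((‖x‖⁻¹ : ℝ) : ℂ) • x, ⟨M.smul_mem _ hx, by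
      rw [norm_smul, Complex.norm_real, norm_inv, norm_norm, inv_mul_cancel₀ hn.ne']⟩, rfl⟩
    simp only [map_smul, norm_smul, Complex.norm_real, norm_inv, norm_norm] at this
    rwa [inv_mul_le_iff₀ hn, mul_comm] at this

theorem aux_finrank_compact (F : H →L[ℂ] H)
    (hF : FiniteDimensional ℂ (LinearMap.range (F : H →ₗ[ℂ] H))) :
    IsCompactOperator (F : H → H) := by
  have : IsCompactOperator (F.codRestrict (LinearMap.range (F : H →ₗ[ℂ] H)) (fun x => ⟨x, rfl⟩)) := by
    have : ProperSpace (LinearMap.range (F : H →ₗ[ℂ] H)) := FiniteDimensional.proper ℂ _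
    exact isCompactOperator_of_locallyCompactSpace_dom
      (F.codRestrict (LinearMap.range (F : H →ₗ[ℂ] H)) (fun x => ⟨x, rfl⟩))
  exact this.clm_comp (LinearMap.range (F : H →ₗ[ℂ] H)).subtypeL

theorem aux_reverse (T : H →L[ℂ] H) (hT : IsSelfAdjoint T) (α : ℝ) (K F : H →L[ℂ] H)
    (hα : 0 ≤ α) (hK : K.IsPositive) (hKc : IsCompactOperator (K : H → H))
    (hF : FiniteDimensional ℂ (LinearMap.range (F : H →ₗ[ℂ] H)))
    (h : T = (α : ℂ) • 1 + K + F) : IsAbsNormAttaining T := by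
  intro M hM hM0
  obtain ⟨s, hs⟩ : ∃ s, s = sSup ((fun x => ‖T x‖) '' {x : H | x ∈ M ∧ ‖x‖ ≤ 1}) := ⟨_, rfl⟩
  rw [← hs]
  obtain ⟨hL, hs0, hle⟩ := aux_sup T M s hs
  have : CompleteSpace M := hM.completeSpace_coe
  rcases le_or_gt s α with hsα | hsα
  · by_cases hx : ∃ x ∈ M, x ≠ 0 ∧ F x = 0
    · obtain ⟨x, hxM, hx0, hFx⟩ := hx
      have hn : 0 < ‖x‖ := norm_pos_iff.2 hx0
      have hTx : T x = (α : ℂ) • x + K x := by rw [h]; simp [hFx]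
      have h1 : α * ‖x‖ ≤ ‖T x‖ := by
        have h2 : ‖T x‖ ^ 2 = (α * ‖x‖) ^ 2 + 2 * (α * (inner ℂ (K x) x).re) + ‖K x‖ ^ 2 := by
          rw [hTx, norm_add_sq (𝕜 := ℂ), norm_smul, Complex.norm_real, Real.norm_of_nonneg hα,
            inner_smul_left, Complex.conj_ofReal, hK.inner_left_eq_inner_right]
          simp
        have h3 : 0 ≤ (inner ℂ (K x) x).re := hK.re_inner_nonneg_left x
        refine le_of_sq_le_sq ?_ (norm_nonneg _)
        rw [h2]
        nlinarith [mul_nonneg hα h3, sq_nonneg ‖K x‖]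
      refine ⟨((‖x‖⁻¹ : ℝ) : ℂ) • x, M.smul_mem _ hxM, ?_, ?_⟩
      · rw [norm_smul, Complex.norm_real, norm_inv, norm_norm, inv_mul_cancel₀ hn.ne']
      · rw [map_smul, norm_smul, Complex.norm_real, norm_inv, norm_norm]
        have := hle x hxM
        rw [inv_mul_eq_iff_eq_mul₀ hn.ne']
        nlinarith
    · push Not at hx
      have hinj : Function.Injective
          ((F : H →ₗ[ℂ] H).rangeRestrict ∘ₗ M.subtype) := by
        rw [← LinearMap.ker_eq_bot, LinearMap.ker_eq_bot']
        intro m hm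
        by_contra hne
        refine hx m m.2 (fun h => hne (Subtype.ext h)) ?_
        exact congrArg Subtype.val hm
      have : FiniteDimensional ℂ M := FiniteDimensional.of_injective _ hinj
      have : ProperSpace M := FiniteDimensional.proper ℂ M
      obtain ⟨x, hx1, hx2⟩ := (isCompact_closedBall (0 : M) 1).exists_isMaxOn ⟨0, by simp⟩
        (f := fun x : M => ‖T x‖) (by fun_prop)
      refine ⟨x, x.2, by simpa using hx1, le_antisymm ?_ ?_⟩
      · exact hL.1 ⟨x, ⟨x.2, by simpa using hx1⟩, rfl⟩
      · refine hL.2 ?_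
        rintro _ ⟨y, ⟨hy, hy1⟩, rfl⟩
        exact hx2 (a := ⟨y, hy⟩) (by simpa using hy1)
  · obtain ⟨u, -, -, hu, hu'⟩ := hL.exists_seq_monotone_tendsto
      ⟨_, 0, ⟨M.zero_mem, by simp⟩, rfl⟩
    choose x hx hxu using hu'
    obtain ⟨C, hC, hCx⟩ := aux_crit T hT M s hle
    set P := M.starProjection
    set S : H →L[ℂ] H := T * (K + F) + (α : ℂ) • (K + F) with hS
    have hKF : IsCompactOperator ((K + F : H →L[ℂ] H) : H → H) :=
      hKc.add (aux_finrank_compact F hF)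
    have hSc : IsCompactOperator ((P ∘L S : H →L[ℂ] H) : H → H) :=
      ((hKF.clm_comp T).add (hKF.smul (α : ℂ))).clm_comp P
    have hTT : ∀ x, T (T x) = ((α ^ 2 : ℝ) : ℂ) • x + S x := by
      intro x
      have e1 : T x = (α : ℂ) • x + (K + F) x := by rw [h]; simp [add_assoc]
      calc T (T x) = T ((α : ℂ) • x + (K + F) x) := by rw [← e1]
        _ = (α : ℂ) • T x + T ((K + F) x) := by rw [map_add, map_smul]
        _ = (α : ℂ) • ((α : ℂ) • x + (K + F) x) + T ((K + F) x) := by rw [← e1]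
        _ = ((α ^ 2 : ℝ) : ℂ) • x + (T ((K + F) x) + (α : ℂ) • (K + F) x) := by
          push_cast
          module
    have hy : ∀ n, P (((s ^ 2 : ℝ) : ℂ) • x n - T (T (x n))) =
        ((s ^ 2 - α ^ 2 : ℝ) : ℂ) • x n - (P ∘L S) (x n) := by
      intro n
      have : P (x n) = x n := Submodule.starProjection_eq_self_iff.2 (hx n).1
      rw [hTT, map_sub, map_add, map_smul, map_smul, this]
      simp only [ContinuousLinearMap.comp_apply]
      push_cast
      module
    have hy0 : Tendsto (fun n => P (((s ^ 2 : ℝ) : ℂ) • x n - T (T (x n)))) atTop (𝓝 0) := by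
      rw [tendsto_zero_iff_norm_tendsto_zero]
      have h2 : Tendsto (fun n => ‖P (((s ^ 2 : ℝ) : ℂ) • x n - T (T (x n)))‖ ^ 2) atTop (𝓝 0) := by
        have h3 : Tendsto (fun n => C * (s ^ 2 - (u n) ^ 2)) atTop (𝓝 0) := by
          have := ((hu.pow 2).const_sub (s ^ 2)).const_mul C
          simpa using this
        refine squeeze_zero (fun n => by positivity) (fun n => ?_) h3
        refine (hCx (x n) (hx n).1).trans ?_
        rw [← hxu n]
        have : ‖x n‖ ^ 2 ≤ 1 := pow_le_one₀ (norm_nonneg _) (hx n).2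
        have h5 : s ^ 2 * ‖x n‖ ^ 2 ≤ s ^ 2 := mul_le_of_le_one_right (by positivity) this
        dsimp only
        gcongr
      have := h2.sqrt
      simpa [Real.sqrt_sq] using this
    obtain ⟨Z, hZ, hZs⟩ := hSc.image_closedBall_subset_compact (f := ((P ∘L S : H →L[ℂ] H) : H →ₗ[ℂ] H)) 1
    obtain ⟨z, -, φ, hφ, hz⟩ := hZ.tendsto_subseq (x := fun n => (P ∘L S) (x n))
      (fun n => hZs ⟨x n, by simpa using (hx n).2, rfl⟩)
    have hd : ((s ^ 2 - α ^ 2 : ℝ) : ℂ) ≠ 0 := by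
      norm_cast
      nlinarith
    have hlim : Tendsto (fun n => x (φ n)) atTop (𝓝 (((s ^ 2 - α ^ 2 : ℝ) : ℂ)⁻¹ • (0 + z))) := by
      have := (((hy0.comp hφ.tendsto_atTop).add hz).const_smul (((s ^ 2 - α ^ 2 : ℝ) : ℂ)⁻¹))
      refine this.congr fun n => ?_
      simp only [Function.comp]
      rw [hy, sub_add_cancel, inv_smul_smul₀ hd]
    refine ⟨_, hM.mem_of_tendsto hlim (Eventually.of_forall fun n => (hx (φ n)).1), ?_, ?_⟩
    · exact le_of_tendsto hlim.norm (Eventually.of_forall fun n => (hx (φ n)).2)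
    · refine tendsto_nhds_unique ((T.continuous.tendsto _).comp hlim).norm ?_
      refine (hu.comp hφ.tendsto_atTop).congr fun n => ?_
      exact (hxu (φ n)).symm

theorem aux_var (T : H →L[ℂ] H) (hT : IsSelfAdjoint T) (hAN : IsAbsNormAttaining T)
    (M : Submodule ℂ H) (hM : IsClosed (M : Set H)) (hM0 : M ≠ ⊥) :
    ∃ (s : ℝ) (x₀ : H), 0 ≤ s ∧ x₀ ∈ M ∧ ‖T x₀‖ = s ∧ (∀ x ∈ M, ‖T x‖ ≤ s * ‖x‖) ∧
      ∀ y ∈ M, inner ℂ (T x₀) (T y) = ((s ^ 2 : ℝ) : ℂ) * inner ℂ x₀ y := by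
  obtain ⟨x₀, hx, hx1, hs⟩ := hAN M hM hM0
  obtain ⟨s, hs'⟩ : ∃ s, s = sSup ((fun x => ‖T x‖) '' {x : H | x ∈ M ∧ ‖x‖ ≤ 1}) := ⟨_, rfl⟩
  rw [← hs'] at hs
  obtain ⟨hL, hs0, hle⟩ := aux_sup T M s hs'
  have : CompleteSpace M := hM.completeSpace_coe
  obtain ⟨C, hC, hCx⟩ := aux_crit T hT M s hle
  refine ⟨s, x₀, hs0, hx, hs, hle, fun y hy => ?_⟩
  have h1 : M.starProjection (((s ^ 2 : ℝ) : ℂ) • x₀ - T (T x₀)) = 0 := by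
    have h2 := hCx x₀ hx
    have h3 : s ^ 2 * ‖x₀‖ ^ 2 - ‖T x₀‖ ^ 2 ≤ 0 := by
      rw [hs, sub_nonpos]
      exact mul_le_of_le_one_right (by positivity) (pow_le_one₀ (norm_nonneg _) hx1)
    have h4 : ‖M.starProjection (((s ^ 2 : ℝ) : ℂ) • x₀ - T (T x₀))‖ ^ 2 ≤ 0 :=
      h2.trans (mul_nonpos_of_nonneg_of_nonpos hC h3)
    have h5 := le_antisymm h4 (by positivity)
    simpa using h5
  rw [Submodule.starProjection_apply_eq_zero_iff] at h1
  have h6 := (Submodule.mem_orthogonal' _ _).1 h1 y hy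
  rw [inner_sub_left, inner_smul_left, Complex.conj_ofReal, sub_eq_zero] at h6
  rw [h6]
  exact (hT.isSymmetric (T x₀) y).symm

theorem aux_noincr (T : H →L[ℂ] H) (hT : IsSelfAdjoint T) (hAN : IsAbsNormAttaining T)
    (g : ℕ → H) (hg : Orthonormal ℂ g)
    (hTg : ∀ m n, m ≠ n → inner ℂ (T (g m)) (T (g n)) = 0)
    (hmono : StrictMono fun n => ‖T (g n)‖) : False := by
  set M := (Submodule.span ℂ (Set.range g)).topologicalClosure with hMdef
  have hgM : ∀ n, g n ∈ M := fun n =>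
    Submodule.le_topologicalClosure _ (Submodule.subset_span ⟨n, rfl⟩)
  have hMc : IsClosed (M : Set H) := Submodule.isClosed_topologicalClosure _
  have hM0 : M ≠ ⊥ := by
    intro h
    have := hgM 0
    rw [h, Submodule.mem_bot] at this
    exact hg.ne_zero 0 this
  obtain ⟨s, x₀, hs0, hx, hs, hle, hvar⟩ := aux_var T hT hAN M hMc hM0
  have key : ∀ x ∈ M, ∀ n, inner ℂ (T x) (T (g n)) = ((‖T (g n)‖ ^ 2 : ℝ) : ℂ) * inner ℂ x (g n) := by
    intro x hx n
    have hcl : IsClosed {x : H | inner ℂ (T x) (T (g n)) =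
        ((‖T (g n)‖ ^ 2 : ℝ) : ℂ) * inner ℂ x (g n)} :=
      isClosed_eq (by fun_prop) (by fun_prop)
    have hsub : (Submodule.span ℂ (Set.range g) : Set H) ⊆ {x : H | inner ℂ (T x) (T (g n)) =
        ((‖T (g n)‖ ^ 2 : ℝ) : ℂ) * inner ℂ x (g n)} := by
      intro y hy
      induction hy using Submodule.span_induction with
      | mem y hy =>
        obtain ⟨m, rfl⟩ := hy
        by_cases hmn : m = n
        · subst hmn
          have := hg.1 m
          simp only [Set.mem_ofPred_eq]
          rw [inner_self_eq_norm_sq_to_K, inner_self_eq_norm_sq_to_K, this]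
          simp
        · simp only [Set.mem_ofPred_eq]
          rw [hTg m n hmn, hg.2 hmn, mul_zero]
      | zero => simp
      | add a b _ _ ha hb =>
        simp only [Set.mem_ofPred_eq] at ha hb ⊢
        rw [map_add, inner_add_left, inner_add_left, ha, hb, mul_add]
      | smul c a _ ha =>
        simp only [Set.mem_ofPred_eq] at ha ⊢
        rw [map_smul, inner_smul_left, inner_smul_left, ha]
        ring
    exact closure_minimal hsub hcl hx
  have hlt : ∀ n, ‖T (g n)‖ < s := by
    intro n
    have h1 := hle _ (hgM (n + 1))
    rw [hg.1, mul_one] at h1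
    exact (hmono (Nat.lt_succ_self n)).trans_le h1
  have hzero : ∀ n, inner ℂ x₀ (g n) = (0 : ℂ) := by
    intro n
    have h1 := key x₀ hx n
    rw [hvar _ (hgM n)] at h1
    have h2 : (((s ^ 2 : ℝ) : ℂ) - ((‖T (g n)‖ ^ 2 : ℝ) : ℂ)) * inner ℂ x₀ (g n) = 0 := by
      rw [sub_mul, h1, sub_self]
    rcases mul_eq_zero.1 h2 with h3 | h3
    · exfalso
      rw [sub_eq_zero, Complex.ofReal_inj] at h3
      have := pow_lt_pow_left₀ (hlt n) (norm_nonneg _) two_ne_zero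
      linarith
    · exact h3
  have hx0 : x₀ = 0 := by
    have hcl : IsClosed {x : H | inner ℂ x₀ x = (0 : ℂ)} := isClosed_eq (by fun_prop) (by fun_prop)
    have hsub : (Submodule.span ℂ (Set.range g) : Set H) ⊆ {x : H | inner ℂ x₀ x = (0 : ℂ)} := by
      intro y hy
      induction hy using Submodule.span_induction with
      | mem y hy =>
        obtain ⟨m, rfl⟩ := hy
        exact hzero m
      | zero => simp
      | add a b _ _ ha hb =>
        simp only [Set.mem_ofPred_eq] at ha hb ⊢
        rw [inner_add_right, ha, hb, add_zero]
      | smul c a _ ha =>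
        simp only [Set.mem_ofPred_eq] at ha ⊢
        rw [inner_smul_right, ha, mul_zero]
    have : inner ℂ x₀ x₀ = (0 : ℂ) := closure_minimal hsub hcl hx
    exact inner_self_eq_zero.1 this
  rw [hx0, map_zero, norm_zero] at hs
  have := hlt 0
  rw [← hs] at this
  exact absurd this (not_lt.2 (norm_nonneg _))

theorem aux_eigvec (T : H →L[ℂ] H) (hT : T.IsPositive) (hAN : IsAbsNormAttaining T)
    (M : Submodule ℂ H) (hM : IsClosed (M : Set H)) (hM0 : M ≠ ⊥)
    (hinv : ∀ x ∈ M, T x ∈ M) : ∃ (x : H) (μ : ℝ), x ∈ M ∧ ‖x‖ = 1 ∧ 0 ≤ μ ∧ T x = (μ : ℂ) • x := by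
  suffices h : ∃ (x : H) (μ : ℝ), x ∈ M ∧ x ≠ 0 ∧ 0 ≤ μ ∧ T x = (μ : ℂ) • x by
    obtain ⟨x, μ, hx, hx0, hμ, hTx⟩ := h
    have hn : 0 < ‖x‖ := norm_pos_iff.2 hx0
    refine ⟨((‖x‖⁻¹ : ℝ) : ℂ) • x, μ, M.smul_mem _ hx, ?_, hμ, ?_⟩
    · rw [norm_smul, Complex.norm_real, norm_inv, norm_norm, inv_mul_cancel₀ hn.ne']
    · rw [map_smul, hTx, smul_comm]
  obtain ⟨s, x₀, hs0, hx, hs, hle, hvar⟩ := aux_var T hT.isSelfAdjoint hAN M hM hM0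
  rcases hs0.eq_or_lt with h0 | hpos
  · obtain ⟨x, hxM, hx0⟩ := (Submodule.ne_bot_iff M).1 hM0
    refine ⟨x, 0, hxM, hx0, le_rfl, ?_⟩
    have := hle x hxM
    rw [← h0, zero_mul] at this
    simpa using this
  · refine ⟨x₀, s, hx, ?_, hs0, ?_⟩
    · rintro rfl
      rw [map_zero, norm_zero] at hs
      exact hpos.ne hs
    have hz2 : T (T x₀) - ((s ^ 2 : ℝ) : ℂ) • x₀ = 0 := by
      set w := T (T x₀) - ((s ^ 2 : ℝ) : ℂ) • x₀ with hw
      have hwM : w ∈ M := M.sub_mem (hinv _ (hinv _ hx)) (M.smul_mem _ hx)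
      have h1 := hvar w hwM
      rw [← inner_self_eq_zero (𝕜 := ℂ)]
      nth_rewrite 1 [hw]
      rw [inner_sub_left, hT.inner_left_eq_inner_right (T x₀) w, h1, inner_smul_left,
        Complex.conj_ofReal, sub_self]
    rw [sub_eq_zero] at hz2
    set z := T x₀ - (s : ℂ) • x₀ with hz
    have hTz : T z = -((s : ℂ) • z) := by
      rw [hz, map_sub, map_smul, hz2]
      push_cast
      module
    have h2 : 0 ≤ (inner ℂ (T z) z).re := hT.re_inner_nonneg_left z
    have h3 : (inner ℂ (T z) z).re = -(s * ‖z‖ ^ 2) := by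
      rw [hTz, inner_neg_left, inner_smul_left, Complex.conj_ofReal, inner_self_eq_norm_sq_to_K]
      change (-((s : ℂ) * ((‖z‖ : ℝ) : ℂ) ^ 2)).re = _
      rw [← Complex.ofReal_pow, ← Complex.ofReal_mul, ← Complex.ofReal_neg, Complex.ofReal_re]
    rw [h3] at h2
    have h4 : ‖z‖ ^ 2 = 0 := by nlinarith [sq_nonneg ‖z‖]
    have h5 : z = 0 := by simpa using h4
    exact sub_eq_zero.1 h5

theorem aux_basis (T : H →L[ℂ] H) (hT : T.IsPositive) (hAN : IsAbsNormAttaining T) :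
    ∃ (v : Set H) (b : HilbertBasis v ℂ H) (μ : v → ℝ), ∀ i, 0 ≤ μ i ∧ T (b i) = (μ i : ℂ) • b i := by
  obtain ⟨v, hv⟩ := zorn_subset {v : Set H | Orthonormal ℂ ((↑) : v → H) ∧
      ∀ x ∈ v, ∃ μ : ℝ, 0 ≤ μ ∧ T x = (μ : ℂ) • x} (by
    intro c hc hchain
    refine ⟨⋃₀ c, ⟨?_, ?_⟩, fun s hs => Set.subset_sUnion_of_mem hs⟩
    · exact orthonormal_sUnion_of_directed hchain.directedOn fun s hs => (hc hs).1
    · rintro x ⟨s, hs, hx⟩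
      exact (hc hs).2 x hx)
  obtain ⟨⟨hvo, hve⟩, hmax⟩ := hv
  have hbot : (Submodule.span ℂ v)ᗮ = ⊥ := by
    by_contra hne
    obtain ⟨e, μ, he, he1, hμ, hTe⟩ := aux_eigvec T hT hAN _
      (Submodule.isClosed_orthogonal _) hne (by
        intro x hx
        have hx' : ∀ u ∈ v, inner ℂ u x = (0 : ℂ) := fun u hu =>
          (Submodule.mem_orthogonal _ _).1 hx u (Submodule.subset_span hu)
        rw [Submodule.mem_orthogonal]
        intro u hu
        induction hu using Submodule.span_induction with
        | mem u hu =>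
          obtain ⟨ν, -, hν⟩ := hve u hu
          rw [← hT.inner_left_eq_inner_right, hν, inner_smul_left, hx' u hu, mul_zero]
        | zero => simp
        | add a b _ _ ha hb => rw [inner_add_left, ha, hb, add_zero]
        | smul c a _ ha => rw [inner_smul_left, ha, mul_zero])
    have h_end : ∀ a ∈ v, inner ℂ a e = (0 : ℂ) := fun a ha =>
      (Submodule.mem_orthogonal _ _).1 he a (Submodule.subset_span ha)
    have hev : e ∉ v := by
      intro hev
      have := h_end e hev
      rw [inner_self_eq_zero] at this
      rw [this, norm_zero] at he1
      exact zero_ne_one he1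
    have hins : insert e v ∈ {v : Set H | Orthonormal ℂ ((↑) : v → H) ∧
        ∀ x ∈ v, ∃ μ : ℝ, 0 ≤ μ ∧ T x = (μ : ℂ) • x} := by
      refine ⟨⟨?_, ?_⟩, ?_⟩
      · rintro ⟨a, rfl | ha⟩
        · exact he1
        · exact hvo.1 ⟨a, ha⟩
      · rintro ⟨a, rfl | ha⟩ ⟨b, rfl | hb⟩ hab
        · exact absurd rfl hab
        · exact inner_eq_zero_symm.1 (h_end b hb)
        · exact h_end a ha
        · have hne : (⟨a, ha⟩ : v) ≠ ⟨b, hb⟩ := fun h => by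
            have h' : a = b := by injection h
            exact hab (Subtype.ext h')
          exact hvo.2 hne
      · rintro x (rfl | hx)
        · exact ⟨μ, hμ, hTe⟩
        · exact hve x hx
    exact hev (hmax hins (Set.subset_insert e v) (Set.mem_insert e v))
  have hbot' : (Submodule.span ℂ (Set.range ((↑) : v → H)))ᗮ = ⊥ := by
    rw [Subtype.range_coe]; exact hbot
  choose! μ hμ using hve
  refine ⟨v, HilbertBasis.mkOfOrthogonalEqBot hvo hbot', fun i => μ i, fun i => ?_⟩
  rw [HilbertBasis.coe_mkOfOrthogonalEqBot]
  exact hμ i i.2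

theorem aux_inner_pair {ι : Type*} (b : HilbertBasis ι ℂ H) (i j : ℕ → ι)
    (hi : Function.Injective i) (hj : Function.Injective j) (hij : ∀ m n, i m ≠ j n)
    (c d : ℕ → ℝ) (m n : ℕ) :
    inner ℂ ((c m : ℂ) • b (i m) + (d m : ℂ) • b (j m))
      ((c n : ℂ) • b (i n) + (d n : ℂ) • b (j n)) =
      if m = n then ((c m * c n + d m * d n : ℝ) : ℂ) else 0 := by
  classical
  have ho := orthonormal_iff_ite.1 b.orthonormal
  simp only [inner_add_left, inner_add_right, inner_smul_left, inner_smul_right, ho,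
    Complex.conj_ofReal, hi.eq_iff, hj.eq_iff, hij, (hij _ _).symm, if_false]
  split_ifs with h
  · push_cast
    ring
  · simp

theorem aux_gap (T : H →L[ℂ] H) (hT : T.IsPositive) (hAN : IsAbsNormAttaining T)
    {ι : Type*} (b : HilbertBasis ι ℂ H) (μ : ι → ℝ)
    (hμ : ∀ i, 0 ≤ μ i ∧ T (b i) = (μ i : ℂ) • b i) (p q : ℝ) (hpq : p < q)
    (hp : {i | μ i ≤ p}.Infinite) (hq : {i | q ≤ μ i}.Infinite) : False := by
  set i : ℕ → ι := fun n => hp.natEmbedding _ n with hi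
  set j : ℕ → ι := fun n => hq.natEmbedding _ n with hj
  have hip : ∀ n, μ (i n) ≤ p := fun n => (hp.natEmbedding _ n).2
  have hjq : ∀ n, q ≤ μ (j n) := fun n => (hq.natEmbedding _ n).2
  have hi_inj : Function.Injective i := fun m n h =>
    (hp.natEmbedding _).injective (Subtype.ext h)
  have hj_inj : Function.Injective j := fun m n h =>
    (hq.natEmbedding _).injective (Subtype.ext h)
  have hij : ∀ m n, i m ≠ j n := by
    intro m n h
    have h1 := hip m
    have h2 := hjq n
    rw [h] at h1
    linarith
  have hp0 : 0 ≤ p := (hμ (i 0)).1.trans (hip 0)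
  have hpq2 : p ^ 2 < q ^ 2 := pow_lt_pow_left₀ hpq hp0 two_ne_zero
  have hi2 : ∀ n, μ (i n) ^ 2 ≤ p ^ 2 := fun n => pow_le_pow_left₀ (hμ _).1 (hip n) 2
  have hj2 : ∀ n, q ^ 2 ≤ μ (j n) ^ 2 := fun n => pow_le_pow_left₀ (hp0.trans hpq.le) (hjq n) 2
  set c : ℕ → ℝ := fun n => q ^ 2 - (q ^ 2 - p ^ 2) * (1 / ((n : ℝ) + 1)) with hc
  have hcmono : ∀ n, c n < c (n + 1) := by
    intro n
    have h1 : (1 : ℝ) / ((n + 1 : ℕ) + 1 : ℝ) < 1 / ((n : ℝ) + 1) := by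
      apply one_div_lt_one_div_of_lt
      · positivity
      · push_cast
        linarith
    have h2 := mul_lt_mul_of_pos_left h1 (sub_pos.2 hpq2)
    simp only [hc]
    linarith
  have hcp : ∀ n, p ^ 2 ≤ c n := by
    intro n
    have h1 : (1 : ℝ) / ((n : ℝ) + 1) ≤ 1 := by
      rw [div_le_one (by positivity)]
      have : (0 : ℝ) ≤ n := Nat.cast_nonneg n
      linarith
    have h2 := mul_le_mul_of_nonneg_left h1 (sub_pos.2 hpq2).le
    simp only [hc]
    linarith
  have hcq : ∀ n, c n ≤ q ^ 2 := by
    intro n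
    have h2 : 0 ≤ (q ^ 2 - p ^ 2) * ((1 : ℝ) / ((n : ℝ) + 1)) :=
      mul_nonneg (sub_pos.2 hpq2).le (by positivity)
    simp only [hc]
    linarith
  set t : ℕ → ℝ := fun n => (c n - μ (i n) ^ 2) / (μ (j n) ^ 2 - μ (i n) ^ 2) with ht
  have hden : ∀ n, 0 < μ (j n) ^ 2 - μ (i n) ^ 2 := fun n => by
    have := hi2 n
    have := hj2 n
    linarith
  have ht0 : ∀ n, 0 ≤ t n := fun n => div_nonneg (by linarith [hi2 n, hcp n]) (hden n).le
  have ht1 : ∀ n, 0 ≤ 1 - t n := fun n => by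
    rw [sub_nonneg, div_le_one (hden n)]
    linarith [hj2 n, hcq n]
  have htc : ∀ n, (1 - t n) * μ (i n) ^ 2 + t n * μ (j n) ^ 2 = c n := by
    intro n
    have : t n * (μ (j n) ^ 2 - μ (i n) ^ 2) = c n - μ (i n) ^ 2 :=
      div_mul_cancel₀ _ (hden n).ne'
    linarith
  set g : ℕ → H := fun n => ((√(1 - t n) : ℝ) : ℂ) • b (i n) + ((√(t n) : ℝ) : ℂ) • b (j n) with hg
  have hTg : ∀ n, T (g n) = ((√(1 - t n) * μ (i n) : ℝ) : ℂ) • b (i n) +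
      ((√(t n) * μ (j n) : ℝ) : ℂ) • b (j n) := by
    intro n
    simp only [hg, map_add, map_smul, (hμ _).2, smul_smul, Complex.ofReal_mul]
  have hgo : Orthonormal ℂ g := by
    rw [orthonormal_iff_ite]
    intro m n
    have := aux_inner_pair b i j hi_inj hj_inj hij (fun n => √(1 - t n)) (fun n => √(t n)) m n
    rw [this]
    split_ifs with h
    · subst h
      rw [Real.mul_self_sqrt (ht1 m), Real.mul_self_sqrt (ht0 m)]
      simp
    · rfl
  have hTin : ∀ m n, inner ℂ (T (g m)) (T (g n)) = if m = n then ((c m : ℝ) : ℂ) else 0 := by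
    intro m n
    rw [hTg, hTg]
    have := aux_inner_pair b i j hi_inj hj_inj hij (fun n => √(1 - t n) * μ (i n))
      (fun n => √(t n) * μ (j n)) m n
    rw [this]
    split_ifs with h
    · subst h
      congr 1
      have e1 := Real.mul_self_sqrt (ht1 m)
      have e2 := Real.mul_self_sqrt (ht0 m)
      calc _ = (√(1 - t m) * √(1 - t m)) * μ (i m) ^ 2 + (√(t m) * √(t m)) * μ (j m) ^ 2 := by ring
        _ = c m := by rw [e1, e2, htc]
    · rfl
  refine aux_noincr T hT.isSelfAdjoint hAN g hgo (fun m n h => by rw [hTin, if_neg h]) ?_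
  have hnorm : ∀ n, ‖T (g n)‖ = √(c n) := by
    intro n
    have h1 := hTin n n
    rw [if_pos rfl] at h1
    have h2 : ‖T (g n)‖ ^ 2 = c n := by
      rw [← inner_self_eq_norm_sq (𝕜 := ℂ), h1]
      simp
    rw [← h2, Real.sqrt_sq (norm_nonneg _)]
  refine strictMono_nat_of_lt_succ fun n => ?_
  rw [hnorm, hnorm]
  exact Real.sqrt_lt_sqrt ((sq_nonneg p).trans (hcp n)) (hcmono n)

theorem aux_incr (T : H →L[ℂ] H) (hT : T.IsPositive) (hAN : IsAbsNormAttaining T)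
    {ι : Type*} (b : HilbertBasis ι ℂ H) (μ : ι → ℝ)
    (hμ : ∀ i, 0 ≤ μ i ∧ T (b i) = (μ i : ℂ) • b i) (i : ℕ → ι)
    (hmono : StrictMono fun n => μ (i n)) : False := by
  have hinj : Function.Injective i := fun m n h => hmono.injective (congrArg μ h)
  refine aux_noincr T hT.isSelfAdjoint hAN (fun n => b (i n)) (b.orthonormal.comp i hinj) ?_ ?_
  · intro m n hmn
    rw [(hμ _).2, (hμ _).2, inner_smul_left, inner_smul_right, b.orthonormal.2 (hinj.ne hmn)]
    simp
  · have : (fun n => ‖T (b (i n))‖) = fun n => μ (i n) := by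
      funext n
      rw [(hμ _).2, norm_smul, b.orthonormal.1, Complex.norm_real, Real.norm_of_nonneg (hμ _).1,
        mul_one]
    rw [this]
    exact hmono

theorem aux_alpha (T : H →L[ℂ] H) (hT : T.IsPositive) (hAN : IsAbsNormAttaining T)
    {ι : Type*} (b : HilbertBasis ι ℂ H) (μ : ι → ℝ)
    (hμ : ∀ i, 0 ≤ μ i ∧ T (b i) = (μ i : ℂ) • b i) :
    ∃ α : ℝ, 0 ≤ α ∧ {i | μ i < α}.Finite ∧ ∀ a, α < a → {i | a ≤ μ i}.Finite := by
  rcases finite_or_infinite ι with hfin | hinf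
  · exact ⟨0, le_rfl, Set.toFinite _, fun _ _ => Set.toFinite _⟩
  set S : Set ℝ := {a | {i | a ≤ μ i}.Infinite} with hS
  have h0 : (0 : ℝ) ∈ S := by
    change {i | 0 ≤ μ i}.Infinite
    have : {i | 0 ≤ μ i} = Set.univ := Set.eq_univ_of_forall fun i => (hμ i).1
    rw [this]
    exact Set.infinite_univ
  have hbdd : BddAbove S := by
    refine ⟨‖T‖, fun a ha => ?_⟩
    obtain ⟨i, hi⟩ := Set.Infinite.nonempty ha
    have h1 := T.le_opNorm (b i)
    rw [(hμ _).2, norm_smul, b.orthonormal.1, Complex.norm_real, Real.norm_of_nonneg (hμ _).1,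
        mul_one, mul_one] at h1
    exact le_trans hi h1
  refine ⟨sSup S, le_csSup hbdd h0, ?_, ?_⟩
  · have hlow : ∀ a, a < sSup S → {i | μ i ≤ a}.Finite := by
      intro a ha
      obtain ⟨q, hq, haq⟩ := exists_lt_of_lt_csSup ⟨0, h0⟩ ha
      by_contra hcon
      exact aux_gap T hT hAN b μ hμ a q haq hcon hq
    by_contra hcon
    have hcon' : {i | μ i < sSup S}.Infinite := hcon
    have hstep : ∀ x : {i // μ i < sSup S}, ∃ y : {i // μ i < sSup S}, μ x < μ y := by
      intro x
      obtain ⟨y, hy1, hy2⟩ := (hcon'.diff (hlow (μ x) x.2)).nonempty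
      exact ⟨⟨y, hy1⟩, not_le.1 hy2⟩
    choose f hf using hstep
    obtain ⟨x0, hx0⟩ := hcon'.nonempty
    refine aux_incr T hT hAN b μ hμ (fun n => (f^[n] ⟨x0, hx0⟩ : {i // μ i < sSup S})) ?_
    refine strictMono_nat_of_lt_succ fun n => ?_
    rw [Function.iterate_succ_apply']
    exact hf _
  · intro a ha
    by_contra hcon
    exact absurd (le_csSup hbdd (show a ∈ S from hcon)) (not_le.2 ha)

/-- A finite diagonal operator. -/
noncomputable def auxDiag {ι : Type*} (b : HilbertBasis ι ℂ H) (s : Finset ι) (c : ι → ℝ) :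
    H →L[ℂ] H :=
  ∑ i ∈ s, (c i : ℂ) • InnerProductSpace.rankOne ℂ (b i) (b i)

theorem auxDiag_apply {ι : Type*} (b : HilbertBasis ι ℂ H) (s : Finset ι) (c : ι → ℝ) (x : H) :
    auxDiag b s c x = ∑ i ∈ s, (c i : ℂ) • inner ℂ (b i) x • b i := by
  simp [auxDiag, ContinuousLinearMap.sum_apply]

open Classical in
theorem auxDiag_basis {ι : Type*} (b : HilbertBasis ι ℂ H) (s : Finset ι) (c : ι → ℝ) (j : ι) :
    auxDiag b s c (b j) = ((if j ∈ s then c j else 0 : ℝ) : ℂ) • b j := by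
  rw [auxDiag_apply]
  simp only [orthonormal_iff_ite.1 b.orthonormal]
  rw [Finset.sum_congr rfl (g := fun i => if i = j then (c j : ℂ) • b j else 0)]
  · rw [Finset.sum_ite_eq']
    split_ifs <;> simp
  · intro i _
    split_ifs with h
    · subst h; simp
    · simp

theorem auxDiag_selfAdjoint {ι : Type*} (b : HilbertBasis ι ℂ H) (s : Finset ι) (c : ι → ℝ) :
    IsSelfAdjoint (auxDiag b s c) := by
  unfold auxDiag
  refine isSelfAdjoint_sum _ fun i _ => IsSelfAdjoint.smul (Complex.conj_ofReal _) ?_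
  exact (InnerProductSpace.isPositive_rankOne_self (b i)).isSelfAdjoint

theorem auxDiag_finrank {ι : Type*} (b : HilbertBasis ι ℂ H) (s : Finset ι) (c : ι → ℝ) :
    FiniteDimensional ℂ (LinearMap.range (auxDiag b s c : H →ₗ[ℂ] H)) := by
  have hfd : FiniteDimensional ℂ (Submodule.span ℂ (b '' (s : Set ι))) :=
    FiniteDimensional.span_of_finite ℂ (s.finite_toSet.image _)
  refine Submodule.finiteDimensional_of_le (S₂ := Submodule.span ℂ (b '' (s : Set ι))) ?_
  rintro _ ⟨x, rfl⟩
  change auxDiag b s c x ∈ _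
  rw [auxDiag_apply]
  refine Submodule.sum_mem _ fun i hi => Submodule.smul_mem _ _ (Submodule.smul_mem _ _ ?_)
  exact Submodule.subset_span ⟨i, hi, rfl⟩

theorem aux_diag_inner {ι : Type*} (b : HilbertBasis ι ℂ H) (A : H →L[ℂ] H)
    (hA : IsSelfAdjoint A) (ν : ι → ℝ) (h : ∀ i, A (b i) = (ν i : ℂ) • b i) (x : H) (i : ι) :
    inner ℂ (A x) (b i) = (ν i : ℂ) * inner ℂ x (b i) := by
  rw [← inner_smul_right, ← h]
  exact hA.isSymmetric x (b i)

theorem aux_parseval {ι : Type*} (b : HilbertBasis ι ℂ H) (x : H) :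
    HasSum (fun i => ‖inner ℂ x (b i)‖ ^ 2) (‖x‖ ^ 2) := by
  have h1 := b.hasSum_inner_mul_inner x x
  have h2 := Complex.hasSum_re h1
  have h3 : (inner ℂ x x).re = ‖x‖ ^ 2 := inner_self_eq_norm_sq (𝕜 := ℂ) x
  rw [h3] at h2
  refine h2.congr_fun fun i => ?_
  rw [← inner_conj_symm (b i) x, Complex.mul_conj, Complex.ofReal_re, Complex.normSq_eq_norm_sq]

theorem aux_diag_pos {ι : Type*} (b : HilbertBasis ι ℂ H) (A : H →L[ℂ] H)
    (hA : IsSelfAdjoint A) (ν : ι → ℝ) (h : ∀ i, A (b i) = (ν i : ℂ) • b i)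
    (hν : ∀ i, 0 ≤ ν i) : A.IsPositive := by
  rw [ContinuousLinearMap.isPositive_def']
  refine ⟨hA, fun x => ?_⟩
  rw [ContinuousLinearMap.reApplyInnerSelf_apply]
  have h2 := Complex.hasSum_re (b.hasSum_inner_mul_inner (A x) x)
  refine h2.nonneg fun i => ?_
  rw [aux_diag_inner b A hA ν h, mul_assoc, ← inner_conj_symm (b i) x, Complex.mul_conj,
    ← Complex.ofReal_mul, Complex.ofReal_re]
  exact mul_nonneg (hν i) (Complex.normSq_nonneg _)

theorem aux_diag_norm {ι : Type*} (b : HilbertBasis ι ℂ H) (A : H →L[ℂ] H)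
    (hA : IsSelfAdjoint A) (ν : ι → ℝ) (h : ∀ i, A (b i) = (ν i : ℂ) • b i)
    (ε : ℝ) (hε : 0 ≤ ε) (hν : ∀ i, |ν i| ≤ ε) : ‖A‖ ≤ ε := by
  refine A.opNorm_le_bound hε fun x => ?_
  refine le_of_sq_le_sq ?_ (by positivity)
  rw [mul_pow]
  refine hasSum_le (fun i => ?_) (aux_parseval b (A x)) ((aux_parseval b x).mul_left (ε ^ 2))
  rw [aux_diag_inner b A hA ν h, norm_mul, mul_pow, Complex.norm_real, Real.norm_eq_abs]
  gcongr
  exact hν i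

theorem aux_forward (T : H →L[ℂ] H) (hT : T.IsPositive) (hAN : IsAbsNormAttaining T) :
    ∃ (α : ℝ) (K F : H →L[ℂ] H), 0 ≤ α ∧
        K.IsPositive ∧ IsCompactOperator (K : H → H) ∧
        IsSelfAdjoint F ∧ FiniteDimensional ℂ (LinearMap.range (F : H →ₗ[ℂ] H)) ∧
        T = (α : ℂ) • 1 + K + F := by
  classical
  obtain ⟨v, b, μ, hμ⟩ := aux_basis T hT hAN
  obtain ⟨α, hα, hfin, hfin'⟩ := aux_alpha T hT hAN b μ hμ
  set s := hfin.toFinset with hs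
  set F := auxDiag b s (fun i => μ i - α) with hF
  set K : H →L[ℂ] H := T - (α : ℂ) • 1 - F with hK
  set ν : v → ℝ := fun i => if i ∈ s then 0 else μ i - α with hνdef
  have hKsa : IsSelfAdjoint K :=
    (hT.isSelfAdjoint.sub (IsSelfAdjoint.smul (Complex.conj_ofReal _) (IsSelfAdjoint.one _))).sub
      (auxDiag_selfAdjoint _ _ _)
  have hKb : ∀ i, K (b i) = (ν i : ℂ) • b i := by
    intro i
    have : K (b i) = T (b i) - (α : ℂ) • b i - F (b i) := rfl
    rw [this, (hμ i).2, hF, auxDiag_basis, ← sub_smul, ← sub_smul]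
    congr 1
    simp only [hνdef]
    split_ifs <;> simp
  have hν0 : ∀ i, 0 ≤ ν i := by
    intro i
    simp only [hνdef]
    split_ifs with h
    · exact le_rfl
    · simp only [hs, Set.Finite.mem_toFinset, Set.mem_ofPred_eq, not_lt] at h
      linarith
  refine ⟨α, K, F, hα, aux_diag_pos b K hKsa ν hKb hν0, ?_, auxDiag_selfAdjoint _ _ _,
    auxDiag_finrank _ _ _, by rw [hK]; abel⟩
  have hcl := isClosed_setOfPred_isCompactOperator (σ₁₂ := RingHom.id ℂ) (M₁ := H) (M₂ := H)
  have hmem : K ∈ closure {f : H →L[ℂ] H | IsCompactOperator (f : H → H)} := by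
    rw [Metric.mem_closure_iff]
    intro ε hε
    have hfε := hfin' (α + ε / 2) (by linarith)
    refine ⟨auxDiag b hfε.toFinset ν, aux_finrank_compact _ (auxDiag_finrank _ _ _), ?_⟩
    rw [dist_eq_norm]
    refine lt_of_le_of_lt (b := ε / 2) ?_ (by linarith)
    refine aux_diag_norm b _ (hKsa.sub (auxDiag_selfAdjoint _ _ _))
      (fun i => if i ∈ hfε.toFinset then 0 else ν i) ?_ _ (by linarith) ?_
    · intro i
      rw [ContinuousLinearMap.sub_apply, hKb, auxDiag_basis, ← sub_smul]
      congr 1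
      split_ifs <;> simp
    · intro i
      split_ifs with h
      · simp only [abs_zero]; linarith
      · rw [abs_of_nonneg (hν0 i)]
        simp only [Set.Finite.mem_toFinset, Set.mem_ofPred_eq, not_le] at h
        simp only [hνdef]
        split_ifs <;> linarith
  exact hcl.closure_subset hmem

end AuxAN

/-- (Pandey–Paulsen) A positive operator `T` on a complex Hilbert space is absolutely norm
attaining iff `T = α I + K + F` with `α ≥ 0`, `K` positive compact, and `F` self-adjoint of
finite rank. -/
theorem positive_isAbsNormAttaining_iff_decomposition
    {H : Type*} [NormedAddCommGroup H] [InnerProductSpace ℂ H] [CompleteSpace H]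
    (T : H →L[ℂ] H) (hT : T.IsPositive) :
    IsAbsNormAttaining T ↔
      ∃ (α : ℝ) (K F : H →L[ℂ] H), 0 ≤ α ∧
        K.IsPositive ∧ IsCompactOperator (K : H → H) ∧
        IsSelfAdjoint F ∧ FiniteDimensional ℂ (LinearMap.range (F : H →ₗ[ℂ] H)) ∧
        T = (α : ℂ) • 1 + K + F := by
  constructor
  · exact aux_forward T hT
  · rintro ⟨α, K, F, hα, hK, hKc, -, hF, h⟩
    exact aux_reverse T hT.isSelfAdjoint α K F hα hK hKc hF h
end

section
/- Let H be a complex Hilbert space and let T be a bounded linear operator on H. Then T is absolutely norm attaining if and only if the modulus |T| = (T*T)^{1/2} is absolutely norm attaining. -/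
/-- (Pandey–Paulsen) A bounded operator `T` on a complex Hilbert space is absolutely norm
attaining iff its modulus `|T| = (T*T)^{1/2}` is absolutely norm attaining. -/
theorem isAbsNormAttaining_iff_abs
    {H : Type*} [NormedAddCommGroup H] [InnerProductSpace ℂ H] [CompleteSpace H]
    (T : H →L[ℂ] H) :
    IsAbsNormAttaining T ↔
      IsAbsNormAttaining (CFC.sqrt (ContinuousLinearMap.adjoint T * T)) := by
  have h : ∀ x : H, ‖CFC.sqrt (ContinuousLinearMap.adjoint T * T) x‖ = ‖T x‖ := by
    intro x
    have h0 : (0 : H →L[ℂ] H) ≤ ContinuousLinearMap.adjoint T * T := star_mul_self_nonneg T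
    have h1 := CFC.sqrt_mul_sqrt_self (ContinuousLinearMap.adjoint T * T) h0
    have h2 : IsSelfAdjoint (CFC.sqrt (ContinuousLinearMap.adjoint T * T)) :=
      IsSelfAdjoint.of_nonneg (CFC.sqrt_nonneg _)
    have h3 := ContinuousLinearMap.isSelfAdjoint_iff'.mp h2
    generalize CFC.sqrt (ContinuousLinearMap.adjoint T * T) = S at h1 h3
    have e1 := ContinuousLinearMap.apply_norm_sq_eq_inner_adjoint_left S x
    have e2 := ContinuousLinearMap.apply_norm_sq_eq_inner_adjoint_left T x
    have h4 : ContinuousLinearMap.adjoint S * S = ContinuousLinearMap.adjoint T * T := by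
      rw [h3, h1]
    have e3 : ‖S x‖ ^ 2 = ‖T x‖ ^ 2 := by
      rw [e1, e2]
      exact congrArg (fun A : H →L[ℂ] H => RCLike.re (inner ℂ (A x) x)) h4
    exact (sq_eq_sq₀ (norm_nonneg _) (norm_nonneg _)).mp e3
  simp only [IsAbsNormAttaining, h]
end
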